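/- arXiv:1010.1512 — 3 statements merged into one kernel-verified Lean document; each statement's English description precedes it below -/
import Mathlib

section
/- For all λ > 0, sup σ(T^{(2)}) = ‖T^{(2)}‖ = r^{κ+ρ}_λ(0), where r^{κ+ρ}_λ(0) := ((λ − (κ+ρ)Δ)^{−1} δ_0)(0) with Δ the discrete Laplacian on ℓ²(ℤ^d) and δ_0 the indicator of the origin. -/
open Filter Topology

section RandomWalk

variable {G ι : Type*} [AddCommGroup G] [Fintype ι]

/-- The generator of the continuous-time random walk on `G` jumping by `e i` at rate `w i`. -/
def walkGen (w : ι → ℝ) (e : ι → G) (f : G → ℝ) (x : G) : ℝ :=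
  ∑ i, w i * (f (x + e i) - f x)

lemma walkGen_sub (w : ι → ℝ) (e : ι → G) (f g : G → ℝ) (x : G) :
    walkGen w e (f - g) x = walkGen w e f x - walkGen w e g x := by
  simp only [walkGen, ← Finset.sum_sub_distrib, Pi.sub_apply]
  exact Finset.sum_congr rfl fun i _ => by ring

/-- Weak maximum principle for bounded supersolutions. -/
lemma nonneg_of_walkGen_le {w : ι → ℝ} (hw : ∀ i, 0 ≤ w i) {e : ι → G} {lam : ℝ} (hlam : 0 < lam)
    {f : G → ℝ} (hf : BddBelow (Set.range f)) (h : ∀ x, walkGen w e f x ≤ lam * f x) (x : G) :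
    0 ≤ f x := by
  have hm : ∀ y, (⨅ z, f z) ≤ f y := fun y => ciInf_le hf y
  set m := ⨅ z, f z
  set c := ∑ i, w i
  have hc : 0 ≤ c := Finset.sum_nonneg fun i _ => hw i
  have hlow : ∀ y, c * m / (lam + c) ≤ f y := by
    intro y
    have h1 : ∑ i, w i * (m - f y) ≤ walkGen w e f y :=
      Finset.sum_le_sum fun i _ => mul_le_mul_of_nonneg_left (by linarith [hm (y + e i)]) (hw i)
    rw [← Finset.sum_mul] at h1
    rw [div_le_iff₀ (by linarith)]
    nlinarith [h y]
  have : c * m / (lam + c) ≤ m := by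
    have : Nonempty G := ⟨x⟩
    exact le_ciInf hlow
  rw [div_le_iff₀ (by linarith)] at this
  have : 0 ≤ m := by nlinarith
  exact this.trans (hm x)

lemma eq_of_walkGen_eq {w : ι → ℝ} (hw : ∀ i, 0 ≤ w i) {e : ι → G} {lam : ℝ} (hlam : 0 < lam)
    {f g φ : G → ℝ} {C D : ℝ} (hf : ∀ x, |f x| ≤ C) (hg : ∀ x, |g x| ≤ D)
    (hfφ : ∀ x, lam * f x - walkGen w e f x = φ x)
    (hgφ : ∀ x, lam * g x - walkGen w e g x = φ x) : f = g := by
  funext x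
  have bdd : ∀ {f g : G → ℝ} {C D : ℝ}, (∀ x, |f x| ≤ C) → (∀ x, |g x| ≤ D) →
      BddBelow (Set.range (f - g)) := by
    rintro f g C D hf hg
    refine ⟨-C - D, ?_⟩
    rintro _ ⟨y, rfl⟩
    simp only [Pi.sub_apply]
    linarith [(abs_le.1 (hf y)).1, (abs_le.1 (hg y)).2]
  have h1 := nonneg_of_walkGen_le hw hlam (bdd hf hg) (e := e) (fun y => by
    rw [walkGen_sub, Pi.sub_apply]; linarith [hfφ y, hgφ y]) x
  have h2 := nonneg_of_walkGen_le hw hlam (bdd hg hf) (e := e) (fun y => by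
    rw [walkGen_sub, Pi.sub_apply]; linarith [hfφ y, hgφ y]) x
  simp only [Pi.sub_apply] at h1 h2
  linarith

variable [DecidableEq G]

lemma resolvent_nonneg {w : ι → ℝ} (hw : ∀ i, 0 ≤ w i) {e : ι → G} {lam : ℝ} (hlam : 0 < lam)
    {f : G → ℝ} {C : ℝ} (hf : ∀ x, |f x| ≤ C)
    (h : ∀ x, lam * f x - walkGen w e f x = if x = 0 then 1 else 0) (x : G) : 0 ≤ f x := by
  refine nonneg_of_walkGen_le hw hlam (e := e) ⟨-C, ?_⟩ (fun y => ?_) x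
  · rintro _ ⟨y, rfl⟩
    exact (abs_le.1 (hf y)).1
  · have := h y
    split_ifs at this <;> linarith

/-- The resolvent kernel of a random walk is summable: the total time spent in a finite set before
an independent exponential time of rate `lam` is at most `1 / lam` on average. -/
lemma resolvent_summable {w : ι → ℝ} (hw : ∀ i, 0 ≤ w i) {e : ι → G} {lam : ℝ} (hlam : 0 < lam)
    {f : G → ℝ} {C : ℝ} (hf : ∀ x, |f x| ≤ C)
    (h : ∀ x, lam * f x - walkGen w e f x = if x = 0 then 1 else 0) : Summable f := by
  refine summable_of_sum_le (c := 1 / lam) (resolvent_nonneg hw hlam hf h) fun B => ?_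
  have key := nonneg_of_walkGen_le hw hlam (e := e) (f := fun x => 1 / lam - ∑ b ∈ B, f (x + b))
    ⟨1 / lam - ∑ b ∈ B, C, ?_⟩ (fun x => ?_) 0
  · simpa using key
  · rintro _ ⟨y, rfl⟩
    exact sub_le_sub_left (Finset.sum_le_sum fun b _ => (abs_le.1 (hf _)).2) _
  · have h1 : walkGen w e (fun x => 1 / lam - ∑ b ∈ B, f (x + b)) x
        = - ∑ b ∈ B, walkGen w e f (x + b) := by
      simp only [walkGen]
      rw [Finset.sum_comm, ← Finset.sum_neg_distrib]
      refine Finset.sum_congr rfl fun i _ => ?_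
      rw [← Finset.mul_sum, Finset.sum_sub_distrib]
      simp only [add_right_comm x (e i)]
      ring
    have h2 : ∑ b ∈ B, walkGen w e f (x + b)
        = lam * ∑ b ∈ B, f (x + b) - ∑ b ∈ B, if x + b = 0 then (1 : ℝ) else 0 := by
      rw [Finset.mul_sum, ← Finset.sum_sub_distrib]
      exact Finset.sum_congr rfl fun b _ => by linarith [h (x + b)]
    have h3 : (∑ b ∈ B, if x + b = 0 then (1 : ℝ) else 0) ≤ 1 := by
      simp only [add_eq_zero_iff_neg_eq, Finset.sum_ite_eq]
      split_ifs <;> norm_num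
    rw [h1, h2, mul_sub, mul_one_div_cancel hlam.ne']
    linarith

end RandomWalk

section Translation

variable {G : Type*} [AddCommGroup G]

/-- Translation by `z` as a linear isometry of `ℓ²(G)`. -/
noncomputable def lpTranslate (z : G) :
    lp (fun _ : G => ℝ) 2 →ₗᵢ[ℝ] lp (fun _ : G => ℝ) 2 where
  toFun f := ⟨fun x => f (x + z), by
    refine memℓp_gen ?_
    exact ((Equiv.addRight z).summable_iff (f := fun x => ‖f x‖ ^ (2 : ENNReal).toReal)).2
      ((lp.memℓp f).summable (by norm_num))⟩
  map_add' f g := by ext x; rfl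
  map_smul' c f := by ext x; rfl
  norm_map' f := by
    rw [lp.norm_eq_tsum_rpow (by norm_num), lp.norm_eq_tsum_rpow (by norm_num)]
    congr 1
    exact (Equiv.addRight z).tsum_eq (fun x => ‖f x‖ ^ (2 : ENNReal).toReal)

@[simp] lemma lpTranslate_apply (z : G) (f : lp (fun _ : G => ℝ) 2) (x : G) :
    lpTranslate z f x = f (x + z) := rfl

lemma norm_smul_lpTranslate_le {a : G → ℝ} (ha : ∀ z, 0 ≤ a z) (z : G) :
    ‖a z • (lpTranslate z).toContinuousLinearMap‖ ≤ a z := by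
  rw [norm_smul, Real.norm_of_nonneg (ha z)]
  exact mul_le_of_le_one_right (ha z) (lpTranslate z).norm_toContinuousLinearMap_le

lemma summable_smul_lpTranslate {a : G → ℝ} (ha : ∀ z, 0 ≤ a z) (hs : Summable a) :
    Summable fun z => ‖a z • (lpTranslate z).toContinuousLinearMap‖ :=
  hs.of_nonneg_of_le (fun _ => norm_nonneg _) (norm_smul_lpTranslate_le ha)

/-- A convolution operator is the norm-convergent superposition of translations. -/
lemma convolution_eq_tsum {a : G → ℝ} (ha : ∀ z, 0 ≤ a z) (hs : Summable a)
    {T : lp (fun _ : G => ℝ) 2 →L[ℝ] lp (fun _ : G => ℝ) 2}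
    (hT : ∀ f x, T f x = ∑' y, a (y - x) * f y) :
    T = ∑' z, a z • (lpTranslate z).toContinuousLinearMap := by
  have hsum := (summable_smul_lpTranslate ha hs).of_norm.hasSum
  ext f x
  have h1 := (hsum.mapL (ContinuousLinearMap.apply ℝ _ f)).mapL
    (lp.evalCLM ℝ (fun _ : G => ℝ) 2 x)
  have h2 := h1.tsum_eq
  rw [hT, ← (Equiv.addLeft x).tsum_eq]
  refine Eq.trans ?_ h2
  refine tsum_congr fun z => ?_
  change a (x + z - x) * f (x + z) = a z * f (x + z)
  rw [add_sub_cancel_left]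

lemma norm_convolution_le {a : G → ℝ} (ha : ∀ z, 0 ≤ a z) (hs : Summable a)
    {T : lp (fun _ : G => ℝ) 2 →L[ℝ] lp (fun _ : G => ℝ) 2}
    (hT : ∀ f x, T f x = ∑' y, a (y - x) * f y) : ‖T‖ ≤ ∑' z, a z := by
  rw [convolution_eq_tsum ha hs hT]
  have h := summable_smul_lpTranslate ha hs
  exact (norm_tsum_le_tsum_norm h).trans (h.tsum_le_tsum (norm_smul_lpTranslate_le ha) hs)

/-- If `ℓ²(G)` has almost invariant unit vectors, the total mass of a nonnegative kernel lies in
the spectrum of its convolution operator. -/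
lemma tsum_mem_spectrum_convolution {a : G → ℝ} (ha : ∀ z, 0 ≤ a z) (hs : Summable a)
    {T : lp (fun _ : G => ℝ) 2 →L[ℝ] lp (fun _ : G => ℝ) 2}
    (hT : ∀ f x, T f x = ∑' y, a (y - x) * f y)
    (g : ℕ → lp (fun _ : G => ℝ) 2) (hg : ∀ n, ‖g n‖ = 1)
    (hinv : ∀ z, Tendsto (fun n => ‖lpTranslate z (g n) - g n‖) atTop (𝓝 0)) :
    (∑' z, a z) ∈ spectrum ℝ T := by
  rw [spectrum.mem_iff]
  rintro ⟨u, hu⟩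
  have hbound : ∀ n z, ‖lpTranslate z (g n) - g n‖ ≤ 2 := fun n z => by
    refine (norm_sub_le _ _).trans ?_
    rw [LinearIsometry.norm_map, hg]
    norm_num
  have hlim : Tendsto (fun n => ∑' z, a z * ‖lpTranslate z (g n) - g n‖) atTop (𝓝 0) := by
    have := tendsto_tsum_of_dominated_convergence
      (f := fun n z => a z * ‖lpTranslate z (g n) - g n‖) (g := fun _ => (0 : ℝ))
      (bound := fun z => a z * 2) (𝓕 := atTop) (hs.mul_right 2)
      (fun z => by simpa using (hinv z).const_mul (a z))
      (Eventually.of_forall fun n z => by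
        rw [Real.norm_of_nonneg (mul_nonneg (ha z) (norm_nonneg _))]
        exact mul_le_mul_of_nonneg_left (hbound n z) (ha z))
    simpa using this
  have happ : ∀ n, ‖(u : lp (fun _ : G => ℝ) 2 →L[ℝ] lp (fun _ : G => ℝ) 2) (g n)‖
      ≤ ∑' z, a z * ‖lpTranslate z (g n) - g n‖ := by
    intro n
    have h1 : HasSum (fun z => a z • lpTranslate z (g n)) (T (g n)) := by
      rw [convolution_eq_tsum ha hs hT]
      exact (summable_smul_lpTranslate ha hs).of_norm.hasSum.mapL
        (ContinuousLinearMap.apply ℝ _ (g n))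
    have h2 : HasSum (fun z => a z • g n) ((∑' z, a z) • g n) := hs.hasSum.smul_const (g n)
    have h3 := h1.sub h2
    have hs' : Summable fun z => a z * ‖lpTranslate z (g n) - g n‖ :=
      (hs.mul_right 2).of_nonneg_of_le (fun z => mul_nonneg (ha z) (norm_nonneg _))
        fun z => mul_le_mul_of_nonneg_left (hbound n z) (ha z)
    have hu' : (u : lp (fun _ : G => ℝ) 2 →L[ℝ] lp (fun _ : G => ℝ) 2) (g n)
        = -(T (g n) - (∑' z, a z) • g n) := by
      rw [hu]; simp [Algebra.algebraMap_eq_smul_one]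
    rw [hu', norm_neg, ← h3.tsum_eq]
    refine tsum_of_norm_bounded hs'.hasSum fun z => ?_
    rw [← smul_sub, norm_smul, Real.norm_of_nonneg (ha z)]
  have hone : ∀ n, 1 ≤ ‖(↑u⁻¹ : lp (fun _ : G => ℝ) 2 →L[ℝ] lp (fun _ : G => ℝ) 2)‖
      * ∑' z, a z * ‖lpTranslate z (g n) - g n‖ := by
    intro n
    have h1 : (↑u⁻¹ : lp (fun _ : G => ℝ) 2 →L[ℝ] lp (fun _ : G => ℝ) 2)
        ((u : lp (fun _ : G => ℝ) 2 →L[ℝ] lp (fun _ : G => ℝ) 2) (g n)) = g n := by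
      rw [← mul_apply_eq_comp, Units.inv_mul, one_apply_eq_self]
    rw [← hg n]
    conv_lhs => rw [← h1]
    exact (ContinuousLinearMap.le_opNorm _ _).trans
      (mul_le_mul_of_nonneg_left (happ n) (norm_nonneg _))
  have := ge_of_tendsto' (hlim.const_mul _) hone
  norm_num at this

end Translation

section IntegerLattice

variable {d : ℕ}

lemma summable_exp_neg_mul_abs {ε : ℝ} (hε : 0 < ε) :
    Summable fun n : ℤ => Real.exp (-ε * |(n : ℝ)|) := by
  have h : Summable fun n : ℕ => Real.exp (-ε * |((n : ℤ) : ℝ)|) := by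
    have := Real.summable_exp_nat_mul_iff.2 (neg_lt_zero.2 hε)
    refine this.congr fun n => ?_
    simp [mul_comm]
  exact Summable.of_nat_of_neg h (by simpa using h)

lemma summable_pi_prod {ι α : Type*} [Fintype ι] {f : α → ℝ} (hf0 : ∀ a, 0 ≤ f a)
    (hf : Summable f) : Summable fun x : ι → α => ∏ i, f (x i) := by
  classical
  refine summable_of_sum_le (c := ∏ _i : ι, ∑' a, f a)
    (fun x => Finset.prod_nonneg fun i _ => hf0 _) fun B => ?_
  calc ∑ x ∈ B, ∏ i, f (x i)
      ≤ ∑ x ∈ Fintype.piFinset fun i => B.image fun x => x i, ∏ i, f (x i) := by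
        refine Finset.sum_le_sum_of_subset_of_nonneg (fun x hx => ?_)
          fun x _ _ => Finset.prod_nonneg fun i _ => hf0 _
        exact Fintype.mem_piFinset.2 fun i => Finset.mem_image_of_mem _ hx
    _ = ∏ i, ∑ a ∈ B.image fun x => x i, f a := (Finset.prod_univ_sum _ _).symm
    _ ≤ _ := Finset.prod_le_prod (fun i _ => Finset.sum_nonneg fun a _ => hf0 a)
        fun i _ => hf.sum_le_tsum _ fun a _ => hf0 a

/-- The `ℓ¹` norm on `ℤ^d`. -/
def l1Norm (x : Fin d → ℤ) : ℝ := ∑ i, |(x i : ℝ)|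

lemma l1Norm_nonneg (x : Fin d → ℤ) : 0 ≤ l1Norm x := Finset.sum_nonneg fun _ _ => abs_nonneg _

lemma abs_l1Norm_add_sub_le (x z : Fin d → ℤ) : |l1Norm (x + z) - l1Norm x| ≤ l1Norm z := by
  rw [l1Norm, l1Norm, ← Finset.sum_sub_distrib]
  refine (Finset.abs_sum_le_sum_abs _ _).trans (Finset.sum_le_sum fun i _ => ?_)
  simpa using abs_abs_sub_abs_le ((x i : ℝ) + z i) (x i)

/-- The function `x ↦ exp (-ε |x|₁)` as an element of `ℓ²(ℤ^d)`. -/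
noncomputable def expDecay {ε : ℝ} (hε : 0 < ε) : lp (fun _ : Fin d → ℤ => ℝ) 2 :=
  ⟨fun x => Real.exp (-ε * l1Norm x), by
    refine memℓp_gen ?_
    refine (summable_pi_prod (fun _ => (Real.exp_pos _).le)
      (summable_exp_neg_mul_abs (mul_pos two_pos hε))).congr fun x => ?_
    rw [← Real.exp_sum, ← Finset.mul_sum, Real.norm_of_nonneg (Real.exp_pos _).le,
      ← Real.exp_mul, l1Norm]
    norm_num
    ring⟩

lemma expDecay_apply {ε : ℝ} (hε : 0 < ε) (x : Fin d → ℤ) :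
    expDecay hε x = Real.exp (-ε * l1Norm x) := rfl

lemma expDecay_norm_pos {ε : ℝ} (hε : 0 < ε) : 0 < ‖expDecay (d := d) hε‖ := by
  refine norm_pos_iff.2 fun h => ?_
  have h0 := expDecay_apply (d := d) hε 0
  rw [h] at h0
  exact (Real.exp_pos _).ne h0

lemma abs_exp_sub_one_le_exp {t b : ℝ} (h : |t| ≤ b) : |Real.exp t - 1| ≤ Real.exp b - 1 := by
  obtain ⟨h1, h2⟩ := abs_le.1 h
  rw [abs_le]
  constructor
  · linarith [Real.add_one_le_exp t, Real.add_one_le_exp b]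
  · linarith [Real.exp_le_exp.2 h2]

lemma norm_lpTranslate_expDecay_sub_le {ε : ℝ} (hε : 0 < ε) (z : Fin d → ℤ) :
    ‖lpTranslate z (expDecay hε) - expDecay hε‖
      ≤ (Real.exp (ε * l1Norm z) - 1) * ‖expDecay (d := d) hε‖ := by
  have hc : 0 ≤ Real.exp (ε * l1Norm z) - 1 := by
    linarith [Real.add_one_le_exp (ε * l1Norm z), mul_nonneg hε.le (l1Norm_nonneg z)]
  rw [← Real.norm_of_nonneg hc, ← norm_smul]
  refine lp.norm_mono (by norm_num) fun x => ?_
  rw [lp.coeFn_sub, lp.coeFn_smul, Pi.sub_apply, Pi.smul_apply, lpTranslate_apply, norm_smul,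
    Real.norm_of_nonneg hc, expDecay_apply, expDecay_apply,
    Real.norm_of_nonneg (Real.exp_pos _).le]
  have h1 : Real.exp (-ε * l1Norm (x + z)) - Real.exp (-ε * l1Norm x)
      = (Real.exp (-ε * (l1Norm (x + z) - l1Norm x)) - 1) * Real.exp (-ε * l1Norm x) := by
    rw [sub_mul, ← Real.exp_add]
    ring_nf
  rw [h1, norm_mul, Real.norm_of_nonneg (Real.exp_pos (-ε * l1Norm x)).le]
  refine mul_le_mul_of_nonneg_right (abs_exp_sub_one_le_exp ?_) (Real.exp_pos _).le
  rw [abs_mul, abs_neg, abs_of_pos hε]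
  exact mul_le_mul_of_nonneg_left (abs_l1Norm_add_sub_le x z) hε.le

/-- `ℓ²(ℤ^d)` has almost invariant unit vectors. -/
lemma exists_almost_invariant (d : ℕ) : ∃ g : ℕ → lp (fun _ : Fin d → ℤ => ℝ) 2,
    (∀ n, ‖g n‖ = 1) ∧
      ∀ z, Tendsto (fun n => ‖lpTranslate z (g n) - g n‖) atTop (𝓝 0) := by
  have hε : ∀ n : ℕ, 0 < 1 / ((n : ℝ) + 1) := fun n => by positivity
  refine ⟨fun n => ‖expDecay (d := d) (hε n)‖⁻¹ • expDecay (hε n), fun n => ?_, fun z => ?_⟩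
  · rw [norm_smul, norm_inv, norm_norm, inv_mul_cancel₀ (expDecay_norm_pos _).ne']
  · have hlim : Tendsto (fun n : ℕ => Real.exp (1 / ((n : ℝ) + 1) * l1Norm z) - 1) atTop (𝓝 0) := by
      have h := (tendsto_one_div_add_atTop_nhds_zero_nat (𝕜 := ℝ)).mul_const (l1Norm z)
      have h' := ((Real.continuous_exp.tendsto _).comp h).sub_const 1
      simpa using h'
    refine squeeze_zero (fun _ => norm_nonneg _) (fun n => ?_) hlim
    rw [map_smul, ← smul_sub, norm_smul, norm_inv, norm_norm,
      inv_mul_le_iff₀ (expDecay_norm_pos _), mul_comm]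
    exact norm_lpTranslate_expDecay_sub_le (hε n) z

end IntegerLattice

section Marginal

variable {d : ℕ}

/-- Jumps of a pair of walks on `ℤ^d`: each walk separately, or both together. -/
def pairStep (p : Fin d × Fin 6) : (Fin d → ℤ) × (Fin d → ℤ) :=
  ![(Pi.single p.1 1, 0), (-Pi.single p.1 1, 0), (0, Pi.single p.1 1), (0, -Pi.single p.1 1),
    (Pi.single p.1 1, Pi.single p.1 1), (-Pi.single p.1 1, -Pi.single p.1 1)] p.2

/-- Jump rates attached to `pairStep`. -/
def pairRate (κ ρ : ℝ) (p : Fin d × Fin 6) : ℝ := ![κ, κ, κ, κ, ρ, ρ] p.2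

/-- Jumps of the simple random walk on `ℤ^d`. -/
def simpleStep (p : Fin d × Fin 2) : Fin d → ℤ := ![Pi.single p.1 1, -Pi.single p.1 1] p.2

lemma pairRate_nonneg {κ ρ : ℝ} (hκ : 0 ≤ κ) (hρ : 0 ≤ ρ) (p : Fin d × Fin 6) :
    0 ≤ pairRate κ ρ p := by
  obtain ⟨j, k⟩ := p
  fin_cases k <;> simpa [pairRate]

lemma walkGen_pair (κ ρ : ℝ) (f : (Fin d → ℤ) × (Fin d → ℤ) → ℝ)
    (q : (Fin d → ℤ) × (Fin d → ℤ)) :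
    walkGen (pairRate κ ρ) pairStep f q = κ * (∑ j : Fin d,
          ((f (q.1 + Pi.single j 1, q.2) - f q) + (f (q.1 - Pi.single j 1, q.2) - f q)
            + (f (q.1, q.2 + Pi.single j 1) - f q) + (f (q.1, q.2 - Pi.single j 1) - f q)))
        + ρ * (∑ j : Fin d,
          ((f (q.1 + Pi.single j 1, q.2 + Pi.single j 1) - f q)
            + (f (q.1 - Pi.single j 1, q.2 - Pi.single j 1) - f q))) := by
  obtain ⟨x, y⟩ := q
  simp only [walkGen, Fintype.sum_prod_type, Finset.mul_sum, ← Finset.sum_add_distrib]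
  refine Finset.sum_congr rfl fun j _ => ?_
  simp [Fin.sum_univ_six, pairRate, pairStep, sub_eq_add_neg]
  ring

lemma walkGen_simple (c : ℝ) (f : (Fin d → ℤ) → ℝ) (x : Fin d → ℤ) :
    walkGen (fun _ => c) simpleStep f x = c * ∑ j : Fin d,
        ((f (x + Pi.single j 1) - f x) + (f (x - Pi.single j 1) - f x)) := by
  simp only [walkGen, Fintype.sum_prod_type, Finset.mul_sum]
  refine Finset.sum_congr rfl fun j _ => ?_
  simp [simpleStep, sub_eq_add_neg]
  ring

/-- Summing out the first coordinate turns the pair generator into that of a simple random walk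
of rate `κ + ρ`. -/
lemma tsum_walkGen_pair (κ ρ : ℝ) {f : (Fin d → ℤ) × (Fin d → ℤ) → ℝ} (hf : Summable f)
    (y : Fin d → ℤ) :
    ∑' x, walkGen (pairRate κ ρ) pairStep f (x, y)
      = walkGen (fun _ => κ + ρ) simpleStep (fun y => ∑' x, f (x, y)) y := by
  have hfib : ∀ v y, Summable fun x => f (x + v, y) := fun v y =>
    (hf.comp_injective (i := fun x => (x + v, y)) fun a b h => by simpa using h)
  have hshift : ∀ v y, ∑' x, f (x + v, y) = ∑' x, f (x, y) := fun v y =>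
    (Equiv.addRight v).tsum_eq fun x => f (x, y)
  have hfib0 : ∀ y, Summable fun x => f (x, y) := fun y => by simpa using hfib 0 y
  have hs : ∀ p : Fin d × Fin 6, Summable fun x =>
      pairRate κ ρ p * (f ((x, y) + pairStep p) - f (x, y)) := fun p =>
    ((hfib (pairStep p).1 (y + (pairStep p).2)).sub (hfib0 y)).mul_left _
  have ht : ∀ p : Fin d × Fin 6, ∑' x, pairRate κ ρ p * (f ((x, y) + pairStep p) - f (x, y))
      = pairRate κ ρ p * (∑' x, f (x, y + (pairStep p).2) - ∑' x, f (x, y)) := fun p => by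
    rw [tsum_mul_left, ← hshift (pairStep p).1 (y + (pairStep p).2),
      ← (hfib (pairStep p).1 (y + (pairStep p).2)).tsum_sub (hfib0 y)]
    rfl
  simp only [walkGen]
  rw [Summable.tsum_finsetSum fun p _ => hs p]
  simp only [ht, Fintype.sum_prod_type]
  refine Finset.sum_congr rfl fun j _ => ?_
  simp [Fin.sum_univ_six, pairRate, pairStep, simpleStep]
  ring

end Marginal

/-- For `λ > 0`, the operator `T⁽²⁾` on `ℓ²(ℤ^d)` given by the
kernel `(x,y) ↦ r²_λ(y−x,0)`, with `r²_λ = (λ − A²)⁻¹δ_{(0,0)}`, satisfies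
`sup σ(T⁽²⁾) = ‖T⁽²⁾‖ = r^{κ+ρ}_λ(0)`, where
`r^{κ+ρ}_λ(0) = ((λ − (κ+ρ)Δ)⁻¹δ_0)(0)` with `Δ` the discrete Laplacian on
`ℓ²(ℤ^d)`. -/
theorem sup_spectrum_T2
    (d : ℕ) (hd : 1 ≤ d)
    (κ ρ : ℝ) (hκ : 0 < κ) (hρ : 0 < ρ)
    (A2 : lp (fun _ : (Fin d → ℤ) × (Fin d → ℤ) => ℝ) 2 →L[ℝ]
      lp (fun _ : (Fin d → ℤ) × (Fin d → ℤ) => ℝ) 2)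
    (hA2 : ∀ (f : lp (fun _ : (Fin d → ℤ) × (Fin d → ℤ) => ℝ) 2)
        (q : (Fin d → ℤ) × (Fin d → ℤ)),
      A2 f q = κ * (∑ j : Fin d,
          ((f (q.1 + Pi.single j 1, q.2) - f q) + (f (q.1 - Pi.single j 1, q.2) - f q)
            + (f (q.1, q.2 + Pi.single j 1) - f q) + (f (q.1, q.2 - Pi.single j 1) - f q)))
        + ρ * (∑ j : Fin d,
          ((f (q.1 + Pi.single j 1, q.2 + Pi.single j 1) - f q)
            + (f (q.1 - Pi.single j 1, q.2 - Pi.single j 1) - f q))))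
    (lam : ℝ) (hlam : 0 < lam)
    (δ00 : lp (fun _ : (Fin d → ℤ) × (Fin d → ℤ) => ℝ) 2)
    (hδ00 : ∀ q : (Fin d → ℤ) × (Fin d → ℤ), δ00 q = if q = 0 then 1 else 0)
    (r : lp (fun _ : (Fin d → ℤ) × (Fin d → ℤ) => ℝ) 2)
    (hr : (lam • (1 : lp (fun _ : (Fin d → ℤ) × (Fin d → ℤ) => ℝ) 2 →L[ℝ]
      lp (fun _ : (Fin d → ℤ) × (Fin d → ℤ) => ℝ) 2) - A2) r = δ00)
    (T2 : lp (fun _ : Fin d → ℤ => ℝ) 2 →L[ℝ] lp (fun _ : Fin d → ℤ => ℝ) 2)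
    (hT2 : ∀ (f : lp (fun _ : Fin d → ℤ => ℝ) 2) (x : Fin d → ℤ),
      T2 f x = ∑' y : Fin d → ℤ, r (y - x, 0) * f y)
    (Ld : lp (fun _ : Fin d → ℤ => ℝ) 2 →L[ℝ] lp (fun _ : Fin d → ℤ => ℝ) 2)
    (hLd : ∀ (f : lp (fun _ : Fin d → ℤ => ℝ) 2) (x : Fin d → ℤ),
      Ld f x = ∑ j : Fin d,
        ((f (x + Pi.single j 1) - f x) + (f (x - Pi.single j 1) - f x)))
    (δ0 : lp (fun _ : Fin d → ℤ => ℝ) 2)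
    (hδ0 : ∀ x : Fin d → ℤ, δ0 x = if x = 0 then 1 else 0)
    (s : lp (fun _ : Fin d → ℤ => ℝ) 2)
    (hs : (lam • (1 : lp (fun _ : Fin d → ℤ => ℝ) 2 →L[ℝ] lp (fun _ : Fin d → ℤ => ℝ) 2)
      - (κ + ρ) • Ld) s = δ0) :
    sSup (spectrum ℝ T2) = s 0 ∧ ‖T2‖ = s 0 := by
  have hA : ∀ q, lam * r q - walkGen (pairRate κ ρ) pairStep r q = if q = 0 then 1 else 0 := by
    intro q
    rw [← hδ00 q, ← hr, walkGen_pair, ← hA2]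
    rfl
  have hL : ∀ x, lam * s x - walkGen (fun _ => κ + ρ) simpleStep s x
      = if x = 0 then 1 else 0 := by
    intro x
    rw [← hδ0 x, ← hs, walkGen_simple, ← hLd]
    rfl
  have hrate := pairRate_nonneg (d := d) hκ.le hρ.le
  have hr_bdd : ∀ q, |r q| ≤ ‖r‖ := lp.norm_apply_le_norm two_ne_zero r
  have hs_bdd : ∀ x, |s x| ≤ ‖s‖ := lp.norm_apply_le_norm two_ne_zero s
  have hr_nonneg : ∀ q, 0 ≤ r q := resolvent_nonneg hrate hlam hr_bdd hA
  have hr_sum : Summable fun q => r q := resolvent_summable hrate hlam hr_bdd hA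
  have hfib : ∀ y, Summable fun x => r (x, y) := fun y =>
    hr_sum.comp_injective (i := fun x => (x, y)) fun a b h => by simpa using h
  have hmarg : (fun y => ∑' x, r (x, y)) = s := by
    refine eq_of_walkGen_eq (w := fun _ => κ + ρ) (e := simpleStep) (C := ∑' q, r q)
      (fun _ => (add_pos hκ hρ).le) hlam (fun y => ?_) hs_bdd (fun y => ?_) hL
    · refine (abs_of_nonneg (tsum_nonneg fun x => hr_nonneg (x, y))).trans_le ?_
      exact tsum_comp_le_tsum_of_inj hr_sum hr_nonneg (i := fun x => (x, y))
        fun a b h => by simpa using h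
    · have hgen : Summable fun x => walkGen (pairRate κ ρ) pairStep r (x, y) := by
        have hδ : Summable fun x : Fin d → ℤ => if (x, y) = 0 then (1 : ℝ) else 0 :=
          summable_of_ne_finset_zero (s := {0}) fun x hx => by
            simp only [Finset.mem_singleton] at hx
            simp [Prod.ext_iff, hx]
        refine (((hfib y).mul_left lam).sub hδ).congr fun x => ?_
        rw [← hA (x, y)]
        ring
      rw [← tsum_walkGen_pair κ ρ hr_sum, ← tsum_mul_left,
        ← ((hfib y).mul_left lam).tsum_sub hgen]
      simp only [hA]
      rw [tsum_eq_single 0 fun x hx => by simp [Prod.ext_iff, hx]]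
      simp [Prod.ext_iff]
  have hmass : ∑' z, r (z, 0) = s 0 := congrFun hmarg 0
  have hnorm := norm_convolution_le (fun z => hr_nonneg (z, 0)) (hfib 0) hT2
  obtain ⟨g, hg, hinv⟩ := exists_almost_invariant d
  have hspec := tsum_mem_spectrum_convolution (fun z => hr_nonneg (z, 0)) (hfib 0) hT2 g hg hinv
  rw [hmass] at hnorm hspec
  have : Nontrivial (lp (fun _ : Fin d → ℤ => ℝ) 2) :=
    ⟨g 0, 0, fun h => by simpa [h] using hg 0⟩
  have hle : ∀ k ∈ spectrum ℝ T2, k ≤ s 0 := fun k hk =>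
    (le_abs_self k).trans ((spectrum.norm_le_norm_of_mem hk).trans hnorm)
  exact ⟨(IsGreatest.csSup_eq ⟨hspec, hle⟩),
    hnorm.antisymm ((le_abs_self _).trans (spectrum.norm_le_norm_of_mem hspec))⟩
end

section
/- Suppose γ > 0 and λ_2 := sup σ(H²) > 0. Then the operator T_{λ_2} = T^{(1)} + T^{(2)} on ℓ²(ℤ^d) satisfies: 1/γ = sup σ(T_{λ_2}); there exists a strictly positive function ṽ ∈ ℓ²(ℤ^d) with T_{λ_2} ṽ = (1/γ) ṽ; and 1/γ is isolated in the spectrum of T_{λ_2} (there is δ > 0 with σ(T_{λ_2}) ∩ (1/γ − δ, 1/γ + δ) = {1/γ}). -/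
open Filter Topology

section Spectral

variable {E : Type*} [NormedAddCommGroup E] [InnerProductSpace ℝ E]

/-- Cauchy–Schwarz for the form of a positive symmetric operator. -/
theorem inner_map_sq_le {D : E →L[ℝ] E} (hD : ∀ x y, inner ℝ (D x) y = inner ℝ x (D y))
    (hpos : ∀ x, 0 ≤ inner ℝ (D x) x) (u f : E) :
    inner ℝ (D u) f ^ 2 ≤ inner ℝ (D u) u * inner ℝ (D f) f := by
  have h : ∀ t : ℝ, 0 ≤ inner ℝ (D f) f * (t * t) + (2 * inner ℝ (D u) f) * t
      + inner ℝ (D u) u := fun t => by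
    have h0 := hpos (u + t • f)
    have h1 : inner ℝ (D f) u = inner ℝ (D u) f := by rw [hD, real_inner_comm]
    simp only [map_add, map_smul, inner_add_left, inner_add_right, inner_smul_left,
      inner_smul_right, conj_trivial, h1] at h0
    linarith
  have := discrim_le_zero h
  rw [discrim] at this
  linarith

theorem norm_map_sq_le_opNorm_mul_inner {D : E →L[ℝ] E}
    (hD : ∀ x y, inner ℝ (D x) y = inner ℝ x (D y))
    (hpos : ∀ x, 0 ≤ inner ℝ (D x) x) (f : E) :
    ‖D f‖ ^ 2 ≤ ‖D‖ * inner ℝ (D f) f := by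
  rcases (norm_nonneg (D f)).eq_or_lt with h | h
  · rw [← h]
    simpa using mul_nonneg (norm_nonneg D) (hpos f)
  have h1 := inner_map_sq_le hD hpos f (D f)
  have h2 : inner ℝ (D (D f)) (D f) ≤ ‖D‖ * ‖D f‖ ^ 2 := by
    calc _ ≤ ‖D (D f)‖ * ‖D f‖ := real_inner_le_norm _ _
      _ ≤ ‖D‖ * ‖D f‖ * ‖D f‖ := by gcongr; exact D.le_opNorm _
      _ = _ := by ring
  rw [real_inner_self_eq_norm_sq] at h1
  have h3 : ‖D f‖ ^ 2 * ‖D f‖ ^ 2 ≤ (‖D‖ * inner ℝ (D f) f) * ‖D f‖ ^ 2 := by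
    nlinarith [mul_le_mul_of_nonneg_left h2 (hpos f)]
  exact le_of_mul_le_mul_right h3 (by positivity)

theorem exists_bounded_below_of_isUnit {D : E →L[ℝ] E} (h : IsUnit D) :
    ∃ c, 0 < c ∧ ∀ x, c * ‖x‖ ≤ ‖D x‖ := by
  obtain ⟨u, rfl⟩ := h
  refine ⟨(‖(↑u⁻¹ : E →L[ℝ] E)‖ + 1)⁻¹, by positivity, fun x => ?_⟩
  rw [inv_mul_le_iff₀ (by positivity)]
  have h1 : (↑u⁻¹ : E →L[ℝ] E) ((u : E →L[ℝ] E) x) = x := by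
    rw [← mul_apply_eq_comp, u.inv_mul, one_apply_eq_self]
  calc ‖x‖ = ‖(↑u⁻¹ : E →L[ℝ] E) ((u : E →L[ℝ] E) x)‖ := by rw [h1]
    _ ≤ ‖(↑u⁻¹ : E →L[ℝ] E)‖ * ‖(u : E →L[ℝ] E) x‖ := ContinuousLinearMap.le_opNorm _ _
    _ ≤ _ := by gcongr; linarith

theorem algebraMap_sub_apply (T : E →L[ℝ] E) (μ : ℝ) (x : E) :
    (algebraMap ℝ (E →L[ℝ] E) μ - T) x = μ • x - T x := by
  rw [Algebra.algebraMap_eq_smul_one]; rfl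

theorem symmetric_algebraMap_sub {T : E →L[ℝ] E}
    (hT : ∀ x y, inner ℝ (T x) y = inner ℝ x (T y)) (μ : ℝ) (x y : E) :
    inner ℝ ((algebraMap ℝ (E →L[ℝ] E) μ - T) x) y
      = inner ℝ x ((algebraMap ℝ (E →L[ℝ] E) μ - T) y) := by
  simp only [algebraMap_sub_apply, inner_sub_left, inner_sub_right, inner_smul_left,
    inner_smul_right, conj_trivial, hT]

theorem inner_algebraMap_sub_self (T : E →L[ℝ] E) (μ : ℝ) (x : E) :
    inner ℝ ((algebraMap ℝ (E →L[ℝ] E) μ - T) x) x = μ * ‖x‖ ^ 2 - inner ℝ (T x) x := by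
  rw [algebraMap_sub_apply, inner_sub_left, inner_smul_left, real_inner_self_eq_norm_sq,
    conj_trivial]

/-- A maximiser of the Rayleigh quotient of `T` is an eigenvector when `T² ≤ μ T`. -/
theorem eigenvector_of_rayleigh {T : E →L[ℝ] E} {μ : ℝ} (hμ : 0 ≤ μ)
    (h : ∀ x, ‖T x‖ ^ 2 ≤ μ * inner ℝ (T x) x)
    {v : E} (hv : μ * ‖v‖ ^ 2 ≤ inner ℝ (T v) v) : T v = μ • v := by
  have : ‖T v - μ • v‖ ^ 2 ≤ 0 := by
    rw [norm_sub_sq_real, inner_smul_right, norm_smul, mul_pow, Real.norm_eq_abs, sq_abs]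
    nlinarith [h v]
  rw [← sub_eq_zero, ← norm_eq_zero]
  exact pow_eq_zero_iff two_ne_zero |>.1 (le_antisymm this (by positivity))

/-- If `‖T x‖² ≤ μ ⟪T x, x⟫` then `T ≤ μ`. -/
theorem inner_map_self_le_of_norm_sq_le {T : E →L[ℝ] E} {μ : ℝ} (hμ : 0 < μ)
    (h : ∀ x, ‖T x‖ ^ 2 ≤ μ * inner ℝ (T x) x) (x : E) :
    inner ℝ (T x) x ≤ μ * ‖x‖ ^ 2 := by
  have h1 := real_inner_mul_inner_self_le (T x) x
  rw [real_inner_self_eq_norm_sq, real_inner_self_eq_norm_sq] at h1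
  have h0 : 0 ≤ inner ℝ (T x) x :=
    nonneg_of_mul_nonneg_right ((sq_nonneg _).trans (h x)) hμ
  rcases h0.eq_or_lt with h2 | h2
  · rw [← h2]; positivity
  · refine le_of_mul_le_mul_left (h1.trans ?_) h2
    nlinarith [mul_le_mul_of_nonneg_right (h x) (sq_nonneg ‖x‖)]

variable [CompleteSpace E]

theorem isUnit_of_coercive {D : E →L[ℝ] E} {c : ℝ} (hc : 0 < c)
    (h : ∀ x, c * ‖x‖ ^ 2 ≤ inner ℝ (D x) x) : IsUnit D :=
  ContinuousLinearMap.isUnit_of_forall_le_norm_inner_map D (c := ⟨c, hc.le⟩) hc fun x => by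
    rw [mul_comm]
    exact (h x).trans (Real.le_norm_self _)

theorem isUnit_of_symmetric_of_bounded_below {D : E →L[ℝ] E}
    (hD : ∀ x y, inner ℝ (D x) y = inner ℝ x (D y)) {c : ℝ} (hc : 0 < c)
    (h : ∀ x, c * ‖x‖ ≤ ‖D x‖) : IsUnit D := by
  have : IsUnit (D * D) := isUnit_of_coercive (c := c ^ 2) (by positivity) fun x => by
    rw [mul_apply_eq_comp, hD, real_inner_self_eq_norm_sq, ← mul_pow]
    exact pow_le_pow_left₀ (by positivity) (h x) 2
  exact ((Commute.refl D).isUnit_mul_iff.1 this).1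

theorem notMem_spectrum_of_coercive {T : E →L[ℝ] E} {μ c : ℝ} (hc : 0 < c)
    (h : ∀ x, inner ℝ (T x) x ≤ (μ - c) * ‖x‖ ^ 2) : μ ∉ spectrum ℝ T := by
  rw [spectrum.mem_iff, not_not]
  refine isUnit_of_coercive hc fun x => ?_
  rw [inner_algebraMap_sub_self]
  linarith [h x]

omit [CompleteSpace E] in
theorem exists_coercive_of_notMem_spectrum {T : E →L[ℝ] E}
    (hT : ∀ x y, inner ℝ (T x) y = inner ℝ x (T y)) {μ : ℝ}
    (hμ : ∀ x, inner ℝ (T x) x ≤ μ * ‖x‖ ^ 2) (h : μ ∉ spectrum ℝ T) :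
    ∃ c, 0 < c ∧ ∀ x, inner ℝ (T x) x ≤ (μ - c) * ‖x‖ ^ 2 := by
  rw [spectrum.mem_iff, not_not] at h
  obtain ⟨c, hc, hb⟩ := exists_bounded_below_of_isUnit h
  set P := algebraMap ℝ (E →L[ℝ] E) μ - T
  refine ⟨c ^ 2 / (‖P‖ + 1), by positivity, fun x => ?_⟩
  have hpos : ∀ x, 0 ≤ inner ℝ (P x) x := fun x => by
    rw [inner_algebraMap_sub_self]; linarith [hμ x]
  have h1 := norm_map_sq_le_opNorm_mul_inner (symmetric_algebraMap_sub hT μ) hpos x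
  have h2 : c ^ 2 * ‖x‖ ^ 2 ≤ ‖P x‖ ^ 2 := by
    rw [← mul_pow]; exact pow_le_pow_left₀ (by positivity) (hb x) 2
  have h3 : c ^ 2 / (‖P‖ + 1) * ‖x‖ ^ 2 ≤ inner ℝ (P x) x := by
    rw [div_mul_eq_mul_div, div_le_iff₀ (by positivity)]
    nlinarith [hpos x]
  rw [inner_algebraMap_sub_self] at h3
  linarith

/-- The top of the spectrum of a symmetric operator is its largest Rayleigh quotient. -/
theorem sSup_spectrum_of_symmetric [Nontrivial E] {T : E →L[ℝ] E}
    (hT : ∀ x y, inner ℝ (T x) y = inner ℝ x (T y)) :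
    sSup (spectrum ℝ T) ∈ spectrum ℝ T ∧
      (∀ x, inner ℝ (T x) x ≤ sSup (spectrum ℝ T) * ‖x‖ ^ 2) ∧
      ∀ m, (∀ x, inner ℝ (T x) x ≤ m * ‖x‖ ^ 2) → sSup (spectrum ℝ T) ≤ m := by
  set S : Set ℝ := {m | ∀ x, inner ℝ (T x) x ≤ m * ‖x‖ ^ 2} with hS
  have hne : S.Nonempty := ⟨‖T‖, fun x => by
    calc _ ≤ ‖T x‖ * ‖x‖ := real_inner_le_norm _ _
      _ ≤ ‖T‖ * ‖x‖ * ‖x‖ := by gcongr; exact T.le_opNorm _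
      _ = _ := by ring⟩
  obtain ⟨e, he⟩ := exists_ne (0 : E)
  have he' : 0 < ‖e‖ ^ 2 := by positivity
  have hbdd : BddBelow S := ⟨inner ℝ (T e) e / ‖e‖ ^ 2, fun m hm => by
    rw [div_le_iff₀ he']; exact hm e⟩
  have hM : sInf S ∈ S := by
    refine IsClosed.csInf_mem ?_ hne hbdd
    rw [hS, Set.ofPred_forall]
    exact isClosed_iInter fun x => isClosed_le (by fun_prop) (by fun_prop)
  have hmem : sInf S ∈ spectrum ℝ T := by
    by_contra h
    obtain ⟨c, hc, hb⟩ := exists_coercive_of_notMem_spectrum hT hM h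
    linarith [csInf_le hbdd (show sInf S - c ∈ S from hb)]
  have hgr : IsGreatest (spectrum ℝ T) (sInf S) := ⟨hmem, fun μ hμ => by
    by_contra! h
    exact notMem_spectrum_of_coercive (T := T) (sub_pos.2 h) (fun x => by
      rw [sub_sub_cancel]; exact hM x) hμ⟩
  rw [hgr.csSup_eq]
  exact ⟨hmem, hM, fun m hm => csInf_le hbdd hm⟩

theorem exists_approx_eigenvector {T : E →L[ℝ] E}
    (hT : ∀ x y, inner ℝ (T x) y = inner ℝ x (T y)) {μ : ℝ} (h : μ ∈ spectrum ℝ T)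
    {ε : ℝ} (hε : 0 < ε) : ∃ v : E, ‖v‖ = 1 ∧ ‖μ • v - T v‖ < ε := by
  by_contra! hcon
  rw [spectrum.mem_iff] at h
  refine h (isUnit_of_symmetric_of_bounded_below (symmetric_algebraMap_sub hT μ) hε fun x => ?_)
  rw [algebraMap_sub_apply]
  rcases eq_or_ne x 0 with rfl | hx
  · simp
  have hx' : 0 < ‖x‖ := norm_pos_iff.2 hx
  have := hcon (‖x‖⁻¹ • x) (by rw [norm_smul, norm_inv, norm_norm, inv_mul_cancel₀ hx'.ne'])
  rwa [map_smul, smul_comm, ← smul_sub, norm_smul, norm_inv, norm_norm, inv_mul_eq_div,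
    le_div_iff₀ hx'] at this

/-- Above the numerical range of `T₂`, approximate eigenvectors of a compact perturbation
`T₁ + T₂` accumulate at eigenvectors. -/
theorem exists_subseq_tendsto_eigenvector {T₁ T₂ : E →L[ℝ] E} (hc : IsCompactOperator T₁)
    {s μ : ℝ} (hs : ∀ x, inner ℝ (T₂ x) x ≤ s * ‖x‖ ^ 2) (hμ : s < μ)
    {m : ℕ → ℝ} (hm : Tendsto m atTop (𝓝 μ)) {v : ℕ → E} (hv : ∀ n, ‖v n‖ = 1)
    (happ : Tendsto (fun n => m n • v n - (T₁ + T₂) (v n)) atTop (𝓝 0)) :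
    ∃ w : E, ∃ φ : ℕ → ℕ, StrictMono φ ∧ Tendsto (v ∘ φ) atTop (𝓝 w) ∧ ‖w‖ = 1 ∧
      (T₁ + T₂) w = μ • w := by
  have hcpt := hc.isCompact_closure_image_closedBall (f := (T₁ : E →ₗ[ℝ] E)) 1
  obtain ⟨y, -, φ, hφ, hy⟩ := hcpt.tendsto_subseq (x := fun n => T₁ (v n))
    fun n => subset_closure ⟨v n, by simp [hv n], rfl⟩
  have hu : IsUnit (algebraMap ℝ (E →L[ℝ] E) μ - T₂) :=
    isUnit_of_coercive (sub_pos.2 hμ) fun x => by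
      rw [inner_algebraMap_sub_self]; linarith [hs x]
  obtain ⟨u, hu⟩ := hu
  have hz : Tendsto (fun n => (μ - m n) • v n) atTop (𝓝 0) := by
    rw [tendsto_zero_iff_norm_tendsto_zero]
    have : Tendsto (fun n => |μ - m n|) atTop (𝓝 |μ - μ|) := (tendsto_const_nhds.sub hm).abs
    simpa [norm_smul, hv] using this
  have h1 : Tendsto (fun n => (u : E →L[ℝ] E) (v (φ n))) atTop (𝓝 y) := by
    have := ((happ.comp hφ.tendsto_atTop).add hy).add (hz.comp hφ.tendsto_atTop)
    rw [zero_add, add_zero] at this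
    refine this.congr fun n => ?_
    rw [hu, algebraMap_sub_apply]
    simp only [Function.comp_apply, add_apply, sub_smul]
    abel
  have h2 : Tendsto (v ∘ φ) atTop (𝓝 ((↑u⁻¹ : E →L[ℝ] E) y)) := by
    refine (((↑u⁻¹ : E →L[ℝ] E).continuous.tendsto y).comp h1).congr fun n => ?_
    simp only [Function.comp_apply]
    rw [← mul_apply_eq_comp, u.inv_mul, one_apply_eq_self]
  set w := (↑u⁻¹ : E →L[ℝ] E) y
  refine ⟨w, φ, hφ, h2, ?_, ?_⟩
  · refine tendsto_nhds_unique h2.norm ?_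
    simp [hv]
  · have h3 : Tendsto (fun n => m (φ n) • v (φ n) - (T₁ + T₂) (v (φ n))) atTop
        (𝓝 (μ • w - (T₁ + T₂) w)) :=
      ((hm.comp hφ.tendsto_atTop).smul h2).sub (((T₁ + T₂).continuous.tendsto w).comp h2)
    have := tendsto_nhds_unique h3 (happ.comp hφ.tendsto_atTop)
    exact (sub_eq_zero.1 this).symm

theorem exists_eigenvector_of_mem_spectrum {T₁ T₂ : E →L[ℝ] E} (hc : IsCompactOperator T₁)
    (hT : ∀ x y, inner ℝ ((T₁ + T₂) x) y = inner ℝ x ((T₁ + T₂) y))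
    {s μ : ℝ} (hs : ∀ x, inner ℝ (T₂ x) x ≤ s * ‖x‖ ^ 2) (hμ : s < μ)
    (h : μ ∈ spectrum ℝ (T₁ + T₂)) : ∃ v : E, ‖v‖ = 1 ∧ (T₁ + T₂) v = μ • v := by
  choose v hv hvb using fun n : ℕ =>
    exists_approx_eigenvector hT h (ε := 1 / ((n : ℝ) + 1)) (by positivity)
  obtain ⟨w, -, -, -, hw, hw'⟩ := exists_subseq_tendsto_eigenvector hc hs hμ
    tendsto_const_nhds hv (squeeze_zero_norm (fun n => (hvb n).le)
      tendsto_one_div_add_atTop_nhds_zero_nat)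
  exact ⟨w, hw, hw'⟩

theorem exists_isolated_of_mem_spectrum {T₁ T₂ : E →L[ℝ] E} (hc : IsCompactOperator T₁)
    (hT : ∀ x y, inner ℝ ((T₁ + T₂) x) y = inner ℝ x ((T₁ + T₂) y))
    {s μ : ℝ} (hs : ∀ x, inner ℝ (T₂ x) x ≤ s * ‖x‖ ^ 2) (hμ : s < μ)
    (h : μ ∈ spectrum ℝ (T₁ + T₂)) :
    ∃ δ : ℝ, 0 < δ ∧ spectrum ℝ (T₁ + T₂) ∩ Set.Ioo (μ - δ) (μ + δ) = {μ} := by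
  by_contra! hcon
  have key : ∀ n : ℕ, ∃ m v, m ≠ μ ∧ |m - μ| < min (μ - s) (1 / ((n : ℝ) + 1)) ∧
      ‖v‖ = 1 ∧ (T₁ + T₂) v = m • v := fun n => by
    have hδ : 0 < min (μ - s) (1 / ((n : ℝ) + 1)) := lt_min (sub_pos.2 hμ) (by positivity)
    have hne := hcon _ hδ
    obtain ⟨m, ⟨hm, hm'⟩, hmμ⟩ : ∃ m ∈ spectrum ℝ (T₁ + T₂) ∩ Set.Ioo
        (μ - min (μ - s) (1 / ((n : ℝ) + 1))) (μ + min (μ - s) (1 / ((n : ℝ) + 1))), m ≠ μ := by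
      by_contra! hall
      exact hne (Set.eq_singleton_iff_unique_mem.2 ⟨⟨h, by constructor <;> linarith⟩, hall⟩)
    have habs : |m - μ| < min (μ - s) (1 / ((n : ℝ) + 1)) := by
      rw [abs_lt]; exact ⟨by linarith [hm'.1], by linarith [hm'.2]⟩
    obtain ⟨v, hv, hv'⟩ := exists_eigenvector_of_mem_spectrum hc hT hs
      (by linarith [neg_abs_le (m - μ), min_le_left (μ - s) (1 / ((n : ℝ) + 1))]) hm
    exact ⟨m, v, hmμ, habs, hv, hv'⟩
  choose m v hmμ hm hv hv' using key
  have hlim : Tendsto m atTop (𝓝 μ) := by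
    rw [tendsto_iff_norm_sub_tendsto_zero]
    exact squeeze_zero (fun _ => norm_nonneg _)
      (fun n => (hm n).le.trans (min_le_right _ _)) tendsto_one_div_add_atTop_nhds_zero_nat
  obtain ⟨w, φ, -, hφ, hw, hw'⟩ := exists_subseq_tendsto_eigenvector hc hs hμ hlim hv
    (by simp only [hv', sub_self, tendsto_const_nhds])
  have horth : ∀ n, inner ℝ (v (φ n)) w = 0 := fun n => by
    have := hT (v (φ n)) w
    rw [hv', hw', inner_smul_left, inner_smul_right, conj_trivial] at this
    exact (mul_eq_mul_right_iff.1 this).resolve_left (hmμ _)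
  have h0 : inner ℝ w w = 0 := by
    refine tendsto_nhds_unique (hφ.inner tendsto_const_nhds) ?_
    simp [horth]
  rw [real_inner_self_eq_norm_sq, hw] at h0
  norm_num at h0

end Spectral

section BirmanSchwinger

variable {E F : Type*} [NormedAddCommGroup E] [InnerProductSpace ℝ E] [CompleteSpace E]
  [NormedAddCommGroup F] [InnerProductSpace ℝ F] [CompleteSpace F]

local notation "adj" => ContinuousLinearMap.adjoint

/-- If `‖B f‖² ≤ m ⟪D f, f⟫` for all `f`, then `K := B D⁻¹ B†` satisfies `K² ≤ m K`. -/
theorem norm_sq_le_of_form_bound {D R : E →L[ℝ] E} {B : E →L[ℝ] F} (hDR : D * R = 1) {m : ℝ}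
    (h : ∀ f, ‖B f‖ ^ 2 ≤ m * inner ℝ (D f) f) (v : F) :
    ‖(B ∘L R ∘L adj B) v‖ ^ 2 ≤ m * inner ℝ ((B ∘L R ∘L adj B) v) v := by
  have h1 : D (R (adj B v)) = adj B v := DFunLike.congr_fun hDR _
  have h2 := h (R (adj B v))
  rwa [h1, ContinuousLinearMap.adjoint_inner_left, real_inner_comm] at h2

/-- The Birman–Schwinger principle for `H = μ - D + γ (B₁†B₁ + B₂†B₂)` with `μ = sup σ(H)`, in the
sector symmetric under the exchange of `B₁` and `B₂`. -/
theorem birmanSchwinger [Nontrivial E] [Nontrivial F] {D R H : E →L[ℝ] E} {B₁ B₂ : E →L[ℝ] F}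
    {T₁ T₂ : F →L[ℝ] F}
    (hD : ∀ x y, inner ℝ (D x) y = inner ℝ x (D y)) {γ μ c : ℝ} (hγ : 0 < γ) (hc : 0 < c)
    (hDc : ∀ x, c * ‖x‖ ^ 2 ≤ inner ℝ (D x) x) (hDR : D * R = 1)
    (hH : ∀ x y, inner ℝ (H x) y
      = μ * inner ℝ x y - inner ℝ (D x) y + γ * (inner ℝ (B₁ x) (B₁ y) + inner ℝ (B₂ x) (B₂ y)))
    (hμ : sSup (spectrum ℝ H) = μ)
    (h11 : B₁ ∘L R ∘L adj B₁ = T₂) (h12 : B₁ ∘L R ∘L adj B₂ = T₁)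
    (h21 : B₂ ∘L R ∘L adj B₁ = T₁) (h22 : B₂ ∘L R ∘L adj B₂ = T₂)
    (hT : ∀ v, ∃ w, ‖w‖ = ‖v‖ ∧
      inner ℝ (T₂ v) v - inner ℝ (T₁ v) v ≤ inner ℝ ((T₁ + T₂) w) w) :
    (∀ x y, inner ℝ ((T₁ + T₂) x) y = inner ℝ x ((T₁ + T₂) y)) ∧
    (∀ v, ‖(T₁ + T₂) v‖ ^ 2 ≤ 1 / γ * inner ℝ ((T₁ + T₂) v) v) ∧
    sSup (spectrum ℝ (T₁ + T₂)) = 1 / γ := by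
  have hDR' : ∀ x, D (R x) = x := fun x => DFunLike.congr_fun hDR x
  have hR : ∀ x y, inner ℝ (R x) y = inner ℝ x (R y) := fun x y => by
    rw [← hDR' y, ← hD, hDR', hDR']
  have s1 : ∀ x y, inner ℝ (T₁ x) y = inner ℝ x (T₁ y) := fun x y => by
    nth_rw 1 [← h12]
    rw [← h21]
    simp only [ContinuousLinearMap.comp_apply]
    rw [← ContinuousLinearMap.adjoint_inner_right, hR, ContinuousLinearMap.adjoint_inner_left]
  have s2 : ∀ x y, inner ℝ (T₂ x) y = inner ℝ x (T₂ y) := fun x y => by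
    rw [← h11]
    simp only [ContinuousLinearMap.comp_apply]
    rw [← ContinuousLinearMap.adjoint_inner_right, hR, ContinuousLinearMap.adjoint_inner_left]
  have hsym : ∀ x y, inner ℝ ((T₁ + T₂) x) y = inner ℝ x ((T₁ + T₂) y) := fun x y => by
    simp only [add_apply, inner_add_left, inner_add_right, s1, s2]
  have hHs : ∀ x y, inner ℝ (H x) y = inner ℝ x (H y) := fun x y => by
    rw [hH, real_inner_comm (H y) x, hH, hD, real_inner_comm x y, real_inner_comm (D y) x,
      real_inner_comm (B₁ x), real_inner_comm (B₂ x)]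
  obtain ⟨hmem, hle, -⟩ := sSup_spectrum_of_symmetric hHs
  rw [hμ] at hmem hle
  have hform : ∀ f, γ * (‖B₁ f‖ ^ 2 + ‖B₂ f‖ ^ 2) ≤ inner ℝ (D f) f := fun f => by
    have := hle f
    rw [hH] at this
    simp only [real_inner_self_eq_norm_sq] at this
    linarith
  have hbound : ∀ v, ‖(T₁ + T₂) v‖ ^ 2 ≤ 1 / γ * inner ℝ ((T₁ + T₂) v) v := fun v => by
    set p := adj B₁ v + adj B₂ v
    have e1 : B₁ (R p) = (T₁ + T₂) v := by
      simp only [p, map_add, add_apply, ← h11, ← h12, ContinuousLinearMap.comp_apply, add_comm]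
    have e2 : B₂ (R p) = (T₁ + T₂) v := by
      simp only [p, map_add, add_apply, ← h22, ← h21, ContinuousLinearMap.comp_apply]
    have h3 := hform (R p)
    rw [hDR', e1, e2, inner_add_left, ContinuousLinearMap.adjoint_inner_left,
      ContinuousLinearMap.adjoint_inner_left, e1, e2, real_inner_comm] at h3
    rw [one_div, ← div_eq_inv_mul, le_div_iff₀ hγ]
    linarith
  obtain ⟨-, htle, htmin⟩ := sSup_spectrum_of_symmetric hsym
  refine ⟨hsym, hbound, le_antisymm
    (htmin _ (inner_map_self_le_of_norm_sq_le (by positivity) hbound)) ?_⟩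
  set m := sSup (spectrum ℝ (T₁ + T₂))
  by_contra! hlt
  have hm0 : 0 ≤ m := by
    obtain ⟨e, he⟩ := exists_ne (0 : F)
    have h0 := hbound e
    have h1 : 0 ≤ inner ℝ ((T₁ + T₂) e) e :=
      nonneg_of_mul_nonneg_right ((sq_nonneg _).trans h0) (by positivity)
    exact nonneg_of_mul_nonneg_left (h1.trans (htle e)) (by positivity)
  have hback : ∀ f, ‖B₁ f‖ ^ 2 + ‖B₂ f‖ ^ 2 ≤ m * inner ℝ (D f) f := fun f => by
    have hDf : 0 ≤ inner ℝ (D f) f := (by positivity : 0 ≤ c * ‖f‖ ^ 2).trans (hDc f)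
    set p := adj B₁ (B₁ f) + adj B₂ (B₂ f)
    set N := ‖B₁ f‖ ^ 2 + ‖B₂ f‖ ^ 2 with hN
    have hN0 : 0 ≤ N := by positivity
    have e1 : inner ℝ (D (R p)) f = N := by
      rw [hDR', inner_add_left, ContinuousLinearMap.adjoint_inner_left,
        ContinuousLinearMap.adjoint_inner_left, real_inner_self_eq_norm_sq,
        real_inner_self_eq_norm_sq]
    have hcs := inner_map_sq_le hD
      (fun x => (by positivity : 0 ≤ c * ‖x‖ ^ 2).trans (hDc x)) (R p) f
    rw [e1, hDR'] at hcs
    have e2 : inner ℝ p (R p) = inner ℝ (T₂ (B₁ f)) (B₁ f) + inner ℝ (T₂ (B₂ f)) (B₂ f)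
        + 2 * inner ℝ (T₁ (B₁ f)) (B₂ f) := by
      have f1 : B₁ (R p) = T₂ (B₁ f) + T₁ (B₂ f) := by
        simp only [p, map_add, ← h11, ← h12, ContinuousLinearMap.comp_apply]
      have f2 : B₂ (R p) = T₁ (B₁ f) + T₂ (B₂ f) := by
        simp only [p, map_add, ← h22, ← h21, ContinuousLinearMap.comp_apply]
      rw [inner_add_left, ContinuousLinearMap.adjoint_inner_left,
        ContinuousLinearMap.adjoint_inner_left, f1, f2, inner_add_right, inner_add_right,
        ← s1, ← s2, ← s2, real_inner_comm (T₁ (B₁ f))]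
      ring
    have e3 : inner ℝ p (R p) ≤ m * N := by
      have g1 := htle (B₁ f + B₂ f)
      have g2 : inner ℝ (T₂ (B₁ f - B₂ f)) (B₁ f - B₂ f) - inner ℝ (T₁ (B₁ f - B₂ f)) (B₁ f - B₂ f)
          ≤ m * ‖B₁ f - B₂ f‖ ^ 2 := by
        obtain ⟨w, hw, hw'⟩ := hT (B₁ f - B₂ f)
        exact hw ▸ hw'.trans (htle w)
      have g3 : inner ℝ (T₁ (B₂ f)) (B₁ f) = inner ℝ (T₁ (B₁ f)) (B₂ f) := by
        rw [s1, real_inner_comm]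
      have g4 : inner ℝ (T₂ (B₂ f)) (B₁ f) = inner ℝ (T₂ (B₁ f)) (B₂ f) := by
        rw [s2, real_inner_comm]
      rw [norm_add_sq_real] at g1
      rw [norm_sub_sq_real] at g2
      simp only [add_apply, map_add, map_sub, inner_add_left, inner_add_right, inner_sub_left,
        inner_sub_right, g3, g4] at g1 g2
      rw [e2]
      linarith
    rcases hN0.eq_or_lt with h | h
    · rw [← h]; positivity
    · refine le_of_mul_le_mul_left ?_ h
      nlinarith [mul_le_mul_of_nonneg_right e3 hDf]
  have hγm : 0 < 1 - γ * m := by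
    rw [lt_div_iff₀ hγ] at hlt
    linarith
  refine notMem_spectrum_of_coercive (T := H) (μ := μ) (mul_pos hγm hc) (fun x => ?_) hmem
  rw [hH]
  simp only [real_inner_self_eq_norm_sq]
  nlinarith [mul_le_mul_of_nonneg_left (hback x) hγ.le, mul_le_mul_of_nonneg_left (hDc x) hγm.le]

end BirmanSchwinger

section SquareSummable

open scoped lp

variable {α β : Type*}

theorem l2_hasSum_inner (f g : ℓ²(α, ℝ)) : HasSum (fun x => f x * g x) (inner ℝ f g) := by
  simpa [mul_comm] using lp.hasSum_inner (𝕜 := ℝ) f g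

theorem l2_hasSum_sq (f : ℓ²(α, ℝ)) : HasSum (fun x => f x ^ 2) (‖f‖ ^ 2) := by
  simpa only [sq, real_inner_self_eq_norm_mul_norm] using l2_hasSum_inner f f

theorem memℓp_two_of_summable_sq {f : α → ℝ} (h : Summable fun x => f x ^ 2) :
    Memℓp (E := fun _ : α => ℝ) f 2 :=
  memℓp_gen (by simpa using h)

theorem l2_inner_single_left [DecidableEq α] (x : α) (f : ℓ²(α, ℝ)) :
    inner ℝ (lp.single 2 x (1 : ℝ)) f = f x := by
  rw [lp.inner_single_left]; simp

/-- Composition with an injective map, as an operator on square-summable families. -/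
noncomputable def l2Comp (φ : α → β) (hφ : Function.Injective φ) : ℓ²(β, ℝ) →L[ℝ] ℓ²(α, ℝ) :=
  LinearMap.mkContinuous
    { toFun := fun f => ⟨fun x => f (φ x),
        memℓp_two_of_summable_sq ((l2_hasSum_sq f).summable.comp_injective hφ)⟩
      map_add' := fun _ _ => rfl
      map_smul' := fun _ _ => rfl } 1 fun f => by
    rw [one_mul]
    refine (sq_le_sq₀ (norm_nonneg _) (norm_nonneg _)).1 ?_
    rw [← (l2_hasSum_sq _).tsum_eq, ← (l2_hasSum_sq f).tsum_eq]
    exact tsum_comp_le_tsum_of_inj (l2_hasSum_sq f).summable (fun _ => sq_nonneg _) hφ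

@[simp]
theorem l2Comp_apply (φ : α → β) (hφ : Function.Injective φ) (f : ℓ²(β, ℝ)) (x : α) :
    l2Comp φ hφ f x = f (φ x) := rfl

/-- The pointwise absolute value of a square-summable family. -/
noncomputable def l2Abs (f : ℓ²(α, ℝ)) : ℓ²(α, ℝ) :=
  ⟨fun x => |f x|, memℓp_two_of_summable_sq (by simpa using (l2_hasSum_sq f).summable)⟩

@[simp]
theorem l2Abs_apply (f : ℓ²(α, ℝ)) (x : α) : l2Abs f x = |f x| := rfl

theorem norm_l2Abs (f : ℓ²(α, ℝ)) : ‖l2Abs f‖ = ‖f‖ := by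
  rw [← sq_eq_sq₀ (norm_nonneg _) (norm_nonneg _), ← (l2_hasSum_sq _).tsum_eq,
    ← (l2_hasSum_sq f).tsum_eq]
  simp

theorem l2_inner_mono {f g f' g' : ℓ²(α, ℝ)} (h : ∀ x, f x * g x ≤ f' x * g' x) :
    inner ℝ f g ≤ inner ℝ f' g' :=
  hasSum_le h (l2_hasSum_inner f g) (l2_hasSum_inner f' g')

/-- An operator with nonnegative kernel satisfies `|⟪T v, v⟫| ≤ ⟪T |v|, |v|⟫`. -/
theorem abs_inner_map_self_le_l2Abs {T : ℓ²(α, ℝ) →L[ℝ] ℓ²(α, ℝ)} {k : α → ℓ²(α, ℝ)}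
    (hT : ∀ v x, T v x = inner ℝ (k x) v) (hk : ∀ x y, 0 ≤ k x y) (v : ℓ²(α, ℝ)) :
    |inner ℝ (T v) v| ≤ inner ℝ (T (l2Abs v)) (l2Abs v) := by
  have h : ∀ x, |T v x| ≤ T (l2Abs v) x := fun x => by
    rw [hT, hT, abs_le', ← inner_neg_right]
    refine ⟨l2_inner_mono fun y => ?_, l2_inner_mono fun y => ?_⟩
    · exact mul_le_mul_of_nonneg_left (le_abs_self (v y)) (hk x y)
    · exact mul_le_mul_of_nonneg_left (neg_le_abs (v y)) (hk x y)
  have h' : ∀ x, |T v x * v x| ≤ T (l2Abs v) x * l2Abs v x := fun x => by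
    rw [abs_mul]
    exact mul_le_mul_of_nonneg_right (h x) (abs_nonneg _)
  rw [abs_le', ← inner_neg_right]
  refine ⟨l2_inner_mono fun x => (le_abs_self _).trans (h' x), l2_inner_mono fun x => ?_⟩
  refine le_trans (le_of_eq ?_) ((neg_le_abs _).trans (h' x))
  exact mul_neg (T v x) (v x)

/-- Hilbert–Schmidt operators are compact. -/
theorem isCompactOperator_of_summable_rows {T : ℓ²(α, ℝ) →L[ℝ] ℓ²(β, ℝ)} {k : β → ℓ²(α, ℝ)}
    (hT : ∀ v x, T v x = inner ℝ (k x) v) (hk : Summable fun x => ‖k x‖ ^ 2) :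
    IsCompactOperator T := by
  classical
  set P : Finset β → ℓ²(α, ℝ) →L[ℝ] ℓ²(β, ℝ) := fun F =>
    ∑ x ∈ F, (innerSL ℝ (k x)).smulRight (lp.single 2 x (1 : ℝ)) with hP
  have hPc : ∀ F, IsCompactOperator (P F) := fun F => by
    induction F using Finset.induction_on with
    | empty => simpa [hP] using isCompactOperator_zero
    | insert x F hx ih =>
      simp only [hP, Finset.sum_insert hx]
      have h1 : IsCompactOperator ((innerSL ℝ (k x)).smulRight
          (lp.single 2 x (1 : ℝ) : ℓ²(β, ℝ))) :=
        (isCompactOperator_of_locallyCompactSpace_dom (innerSL ℝ (k x))).clm_comp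
          ((1 : ℝ →L[ℝ] ℝ).smulRight (lp.single 2 x (1 : ℝ) : ℓ²(β, ℝ)))
      exact h1.add ih
  refine isCompactOperator_of_tendsto (l := atTop) (F := P) ?_ (Eventually.of_forall hPc)
  have hPapply : ∀ F v x, (T - P F) v x = if x ∈ F then 0 else inner ℝ (k x) v := fun F v x => by
    rw [sub_apply, lp.coeFn_sub, Pi.sub_apply, hT, hP]
    simp only [sum_apply, ContinuousLinearMap.smulRight_apply, innerSL_apply_apply,
      lp.coeFn_sum, Finset.sum_apply, lp.coeFn_smul, Pi.smul_apply, lp.single_apply,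
      Pi.single_apply, smul_eq_mul, mul_ite, mul_one, mul_zero, Finset.sum_ite_eq]
    split_ifs <;> simp
  have hnorm : ∀ F, ‖P F - T‖ ≤ √(∑' x : {x // x ∉ F}, ‖k x‖ ^ 2) := fun F => by
    rw [norm_sub_rev]
    refine ContinuousLinearMap.opNorm_le_bound _ (Real.sqrt_nonneg _) fun v => ?_
    refine (sq_le_sq₀ (norm_nonneg _) (by positivity)).1 ?_
    rw [mul_pow, Real.sq_sqrt (tsum_nonneg fun _ => by positivity), ← tsum_mul_right,
      ← (l2_hasSum_sq _).tsum_eq]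
    refine le_of_le_of_eq ?_ (tsum_subtype {x | x ∉ F} fun x => ‖k x‖ ^ 2 * ‖v‖ ^ 2).symm
    refine Summable.tsum_le_tsum (fun x => ?_) (l2_hasSum_sq _).summable
      ((hk.mul_right _).indicator _)
    rw [hPapply]
    by_cases hx : x ∈ F
    · simp [hx]
    · rw [if_neg hx, Set.indicator_of_mem (by exact hx), ← mul_pow, sq_le_sq,
        abs_of_nonneg (by positivity : 0 ≤ ‖k x‖ * ‖v‖)]
      exact abs_real_inner_le_norm _ _
  rw [tendsto_iff_norm_sub_tendsto_zero]
  refine squeeze_zero (fun _ => norm_nonneg _) hnorm ?_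
  simpa using (tendsto_tsum_compl_atTop_zero fun x => ‖k x‖ ^ 2).sqrt

end SquareSummable

section Product

open scoped lp

variable {G K : Type*}

/-- The restriction of `f` to the row `{x} × K`. -/
noncomputable def l2Row (x : G) : ℓ²(G × K, ℝ) →L[ℝ] ℓ²(K, ℝ) :=
  l2Comp (Prod.mk x) (Prod.mk_right_injective x)

/-- The restriction of `f` to the column `G × {y}`. -/
noncomputable def l2Col (y : K) : ℓ²(G × K, ℝ) →L[ℝ] ℓ²(G, ℝ) :=
  l2Comp (fun x => (x, y)) (Prod.mk_left_injective y)

@[simp]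
theorem l2Row_apply (x : G) (f : ℓ²(G × K, ℝ)) (y : K) : l2Row x f y = f (x, y) := rfl

@[simp]
theorem l2Col_apply (y : K) (f : ℓ²(G × K, ℝ)) (x : G) : l2Col y f x = f (x, y) := rfl

theorem hasSum_inner_l2Row (f g : ℓ²(G × K, ℝ)) :
    HasSum (fun x => inner ℝ (l2Row x f) (l2Row x g)) (inner ℝ f g) :=
  (l2_hasSum_inner f g).prod_fiberwise fun x => l2_hasSum_inner (l2Row x f) (l2Row x g)

theorem hasSum_norm_l2Row_sq (f : ℓ²(G × K, ℝ)) :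
    HasSum (fun x => ‖l2Row x f‖ ^ 2) (‖f‖ ^ 2) := by
  simpa only [real_inner_self_eq_norm_sq] using hasSum_inner_l2Row f f

/-- The norms of the rows of a square-summable family. -/
noncomputable def l2RowNorm (f : ℓ²(G × K, ℝ)) : ℓ²(G, ℝ) :=
  ⟨fun x => ‖l2Row x f‖, memℓp_two_of_summable_sq (hasSum_norm_l2Row_sq f).summable⟩

@[simp]
theorem l2RowNorm_apply (f : ℓ²(G × K, ℝ)) (x : G) : l2RowNorm f x = ‖l2Row x f‖ := rfl

theorem norm_l2RowNorm_sq (f : ℓ²(G × K, ℝ)) : ‖l2RowNorm f‖ ^ 2 = ‖f‖ ^ 2 :=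
  (l2_hasSum_sq (l2RowNorm f)).unique (hasSum_norm_l2Row_sq f)

/-- The tensor product of two square-summable families. -/
noncomputable def l2Tensor (f : ℓ²(G, ℝ)) (g : ℓ²(K, ℝ)) : ℓ²(G × K, ℝ) :=
  ⟨fun q => f q.1 * g q.2, memℓp_two_of_summable_sq (by
    simpa only [mul_pow] using (l2_hasSum_sq f).summable.mul_of_nonneg (l2_hasSum_sq g).summable
      (fun _ => sq_nonneg _) fun _ => sq_nonneg _)⟩

@[simp]
theorem l2Tensor_apply (f : ℓ²(G, ℝ)) (g : ℓ²(K, ℝ)) (q : G × K) :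
    l2Tensor f g q = f q.1 * g q.2 := rfl

theorem l2Row_l2Tensor (f : ℓ²(G, ℝ)) (g : ℓ²(K, ℝ)) (x : G) :
    l2Row x (l2Tensor f g) = f x • g := rfl

theorem l2Col_l2Tensor (f : ℓ²(G, ℝ)) (g : ℓ²(K, ℝ)) (y : K) :
    l2Col y (l2Tensor f g) = g y • f := by
  ext x; exact mul_comm _ _

theorem inner_l2Tensor (f f' : ℓ²(G, ℝ)) (g g' : ℓ²(K, ℝ)) :
    inner ℝ (l2Tensor f g) (l2Tensor f' g') = inner ℝ f f' * inner ℝ g g' := by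
  refine (hasSum_inner_l2Row _ _).unique ?_
  simp only [l2Row_l2Tensor, inner_smul_left, inner_smul_right, conj_trivial, ← mul_assoc]
  rw [← real_inner_comm f f']
  exact (l2_hasSum_inner f' f).mul_right _

theorem norm_l2Tensor_sq (f : ℓ²(G, ℝ)) (g : ℓ²(K, ℝ)) :
    ‖l2Tensor f g‖ ^ 2 = ‖f‖ ^ 2 * ‖g‖ ^ 2 := by
  simp only [← real_inner_self_eq_norm_sq, inner_l2Tensor]

/-- Exchange of the two coordinates. -/
noncomputable def l2Swap : ℓ²(G × G, ℝ) →L[ℝ] ℓ²(G × G, ℝ) :=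
  l2Comp Prod.swap Prod.swap_injective

@[simp]
theorem l2Swap_apply (f : ℓ²(G × G, ℝ)) (q : G × G) : l2Swap f q = f q.swap := rfl

end Product

section Lattice

open scoped lp

variable {G K : Type*} [AddCommGroup G] [AddCommGroup K]

/-- Translation by `a` on `ℓ²(G)`. -/
noncomputable def l2Shift (a : G) : ℓ²(G, ℝ) →L[ℝ] ℓ²(G, ℝ) :=
  l2Comp (· + a) (add_left_injective a)

@[simp]
theorem l2Shift_apply (a : G) (f : ℓ²(G, ℝ)) (x : G) : l2Shift a f x = f (x + a) := rfl

theorem inner_l2Shift_left (a : G) (f g : ℓ²(G, ℝ)) :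
    inner ℝ (l2Shift a f) g = inner ℝ f (l2Shift (-a) g) := by
  rw [← (l2_hasSum_inner _ _).tsum_eq, ← (l2_hasSum_inner _ _).tsum_eq,
    ← (Equiv.addRight a).tsum_eq fun x => f x * l2Shift (-a) g x]
  simp

theorem norm_l2Shift (a : G) (f : ℓ²(G, ℝ)) : ‖l2Shift a f‖ = ‖f‖ := by
  have h : l2Shift (-a) (l2Shift a f) = f := by ext x; simp
  rw [← sq_eq_sq₀ (norm_nonneg _) (norm_nonneg _), ← real_inner_self_eq_norm_sq,
    inner_l2Shift_left, h, real_inner_self_eq_norm_sq]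

theorem inner_l2Shift_self_le (a : G) (f : ℓ²(G, ℝ)) : inner ℝ (l2Shift a f) f ≤ ‖f‖ ^ 2 := by
  have := real_inner_le_norm (l2Shift a f) f
  rwa [norm_l2Shift, ← sq] at this

/-- The second difference in direction `a` on `ℓ²(G)`. -/
noncomputable def l2Diff (a : G) : ℓ²(G, ℝ) →L[ℝ] ℓ²(G, ℝ) :=
  l2Shift a + l2Shift (-a) - (2 : ℝ) • 1

theorem l2Diff_apply (a : G) (f : ℓ²(G, ℝ)) (x : G) :
    l2Diff a f x = f (x + a) + f (x - a) - 2 * f x := by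
  change f (x + a) + f (x + -a) - 2 * f x = _
  rw [← sub_eq_add_neg]

theorem inner_l2Diff_left (a : G) (f g : ℓ²(G, ℝ)) :
    inner ℝ (l2Diff a f) g = inner ℝ f (l2Diff a g) := by
  simp only [l2Diff, sub_apply, add_apply, smul_apply, one_apply_eq_self, inner_sub_left,
    inner_sub_right, inner_add_left, inner_add_right, inner_smul_left, inner_smul_right,
    inner_l2Shift_left, neg_neg, conj_trivial]
  ring

theorem inner_l2Diff_self (a : G) (f : ℓ²(G, ℝ)) :
    inner ℝ (l2Diff a f) f = 2 * (inner ℝ (l2Shift a f) f - ‖f‖ ^ 2) := by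
  have h : inner ℝ (l2Shift (-a) f) f = inner ℝ (l2Shift a f) f := by
    rw [real_inner_comm, inner_l2Shift_left a]
  simp only [l2Diff, sub_apply, add_apply, smul_apply, one_apply_eq_self, inner_sub_left,
    inner_add_left, inner_smul_left, conj_trivial, h, real_inner_self_eq_norm_sq]
  ring

theorem inner_l2Diff_self_nonpos (a : G) (f : ℓ²(G, ℝ)) : inner ℝ (l2Diff a f) f ≤ 0 := by
  rw [inner_l2Diff_self]
  linarith [inner_l2Shift_self_le a f]

theorem inner_l2Diff_self_le_l2Abs (a : G) (f : ℓ²(G, ℝ)) :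
    inner ℝ (l2Diff a f) f ≤ inner ℝ (l2Diff a (l2Abs f)) (l2Abs f) := by
  rw [inner_l2Diff_self, inner_l2Diff_self, norm_l2Abs]
  have : inner ℝ (l2Shift a f) f ≤ inner ℝ (l2Shift a (l2Abs f)) (l2Abs f) :=
    l2_inner_mono fun x => (le_abs_self _).trans (abs_mul _ _).le
  linarith

theorem l2Diff_l2Shift (a b : G) (f : ℓ²(G, ℝ)) :
    l2Diff a (l2Shift b f) = l2Shift b (l2Diff a f) := by
  ext x
  simp only [l2Diff_apply, l2Shift_apply, add_right_comm, sub_add_eq_add_sub]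

theorem l2Row_l2Shift (a x : G) (b : K) (f : ℓ²(G × K, ℝ)) :
    l2Row x (l2Shift (a, b) f) = l2Shift b (l2Row (x + a) f) := rfl

theorem inner_l2Diff_self_le_l2RowNorm (a : G) (b : K) (f : ℓ²(G × K, ℝ)) :
    inner ℝ (l2Diff (a, b) f) f ≤ inner ℝ (l2Diff a (l2RowNorm f)) (l2RowNorm f) := by
  rw [inner_l2Diff_self, inner_l2Diff_self, norm_l2RowNorm_sq]
  have : inner ℝ (l2Shift (a, b) f) f ≤ inner ℝ (l2Shift a (l2RowNorm f)) (l2RowNorm f) := by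
    refine hasSum_le (fun x => ?_) (hasSum_inner_l2Row _ _) (l2_hasSum_inner _ _)
    refine (real_inner_le_norm _ _).trans_eq ?_
    rw [l2Row_l2Shift, norm_l2Shift]
    rfl
  linarith

theorem l2Shift_l2Tensor (a : G) (b : K) (f : ℓ²(G, ℝ)) (g : ℓ²(K, ℝ)) :
    l2Shift (a, b) (l2Tensor f g) = l2Tensor (l2Shift a f) (l2Shift b g) := rfl

theorem inner_l2Diff_l2Tensor (a : G) (b : K) (f : ℓ²(G, ℝ)) (g : ℓ²(K, ℝ)) :
    inner ℝ (l2Diff (a, b) (l2Tensor f g)) (l2Tensor f g)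
      = 2 * (inner ℝ (l2Shift a f) f * inner ℝ (l2Shift b g) g - ‖f‖ ^ 2 * ‖g‖ ^ 2) := by
  rw [inner_l2Diff_self, l2Shift_l2Tensor, inner_l2Tensor, norm_l2Tensor_sq]

theorem l2Shift_zero (f : ℓ²(G, ℝ)) : l2Shift 0 f = f := by
  ext x; simp

/-- The generator of two walks with own jumps at rate `κ` and common jumps at rate `ρ`, with
jumps in the directions `± e j`. -/
noncomputable def l2Generator {ι : Type*} [Fintype ι] (e : ι → G) (κ ρ : ℝ) :
    ℓ²(G × G, ℝ) →L[ℝ] ℓ²(G × G, ℝ) :=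
  ∑ j, (κ • (l2Diff (e j, 0) + l2Diff (0, e j)) + ρ • l2Diff (e j, e j))

variable {ι : Type*} [Fintype ι] (e : ι → G) {κ ρ : ℝ}

theorem l2Generator_apply (f : ℓ²(G × G, ℝ)) (q : G × G) :
    l2Generator e κ ρ f q = ∑ j, (κ * (l2Diff (e j, 0) f q + l2Diff (0, e j) f q)
      + ρ * l2Diff (e j, e j) f q) := by
  rw [l2Generator, sum_apply, lp.coeFn_sum, Finset.sum_apply]
  rfl

theorem inner_l2Generator (f g : ℓ²(G × G, ℝ)) :
    inner ℝ (l2Generator e κ ρ f) g = ∑ j, (κ * (inner ℝ (l2Diff (e j, 0) f) g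
      + inner ℝ (l2Diff (0, e j) f) g) + ρ * inner ℝ (l2Diff (e j, e j) f) g) := by
  simp only [l2Generator, sum_apply, sum_inner, add_apply, smul_apply, inner_add_left,
    inner_smul_left, conj_trivial]

theorem inner_l2Generator_left (f g : ℓ²(G × G, ℝ)) :
    inner ℝ (l2Generator e κ ρ f) g = inner ℝ f (l2Generator e κ ρ g) := by
  rw [real_inner_comm (l2Generator e κ ρ g) f, inner_l2Generator, inner_l2Generator]
  simp only [inner_l2Diff_left _ f, real_inner_comm _ f]

theorem inner_l2Generator_self_nonpos (hκ : 0 ≤ κ) (hρ : 0 ≤ ρ) (f : ℓ²(G × G, ℝ)) :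
    inner ℝ (l2Generator e κ ρ f) f ≤ 0 := by
  rw [inner_l2Generator]
  refine Finset.sum_nonpos fun j _ => ?_
  nlinarith [inner_l2Diff_self_nonpos (e j, 0) f, inner_l2Diff_self_nonpos (0, e j) f,
    inner_l2Diff_self_nonpos (e j, e j) f]

theorem inner_l2Generator_self_le_l2Abs (hκ : 0 ≤ κ) (hρ : 0 ≤ ρ) (f : ℓ²(G × G, ℝ)) :
    inner ℝ (l2Generator e κ ρ f) f ≤ inner ℝ (l2Generator e κ ρ (l2Abs f)) (l2Abs f) := by
  rw [inner_l2Generator, inner_l2Generator]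
  refine Finset.sum_le_sum fun j _ => ?_
  gcongr <;> exact inner_l2Diff_self_le_l2Abs _ f

theorem l2Generator_l2Shift (a : G × G) (f : ℓ²(G × G, ℝ)) :
    l2Generator e κ ρ (l2Shift a f) = l2Shift a (l2Generator e κ ρ f) := by
  simp only [l2Generator, sum_apply, map_sum, add_apply, smul_apply, map_add, map_smul,
    l2Diff_l2Shift]

theorem l2Generator_l2Swap (f : ℓ²(G × G, ℝ)) :
    l2Generator e κ ρ (l2Swap f) = l2Swap (l2Generator e κ ρ f) := by
  have h : ∀ a b : G, l2Diff (a, b) (l2Swap f) = l2Swap (l2Diff (b, a) f) := fun a b => by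
    ext q; simp only [l2Diff_apply, l2Swap_apply]; rfl
  simp only [l2Generator, sum_apply, map_sum, add_apply, smul_apply, map_add, map_smul, h]
  refine Finset.sum_congr rfl fun j _ => ?_
  rw [add_comm (l2Swap (l2Diff (0, e j) f))]

/-- If `μ` bounds the generator plus `γ` times the indicators of both axes, then the generator with
the potential on one axis only is strictly subcritical at `μ`. -/
theorem exists_form_bound_l2Row_zero (hκ : 0 ≤ κ) (hρ : 0 ≤ ρ) {γ μ : ℝ} (hγ : 0 < γ)
    (hμ : 0 < μ) (h : ∀ f : ℓ²(G × G, ℝ), inner ℝ (l2Generator e κ ρ f) f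
      + γ * (‖l2Row 0 f‖ ^ 2 + ‖l2Col 0 f‖ ^ 2) ≤ μ * ‖f‖ ^ 2) :
    ∃ s, 0 < s ∧ s < 1 / γ ∧ ∀ f : ℓ²(G × G, ℝ),
      ‖l2Row 0 f‖ ^ 2 ≤ s * (μ * ‖f‖ ^ 2 - inner ℝ (l2Generator e κ ρ f) f) := by
  classical
  set L : ℓ²(G, ℝ) →L[ℝ] ℓ²(G, ℝ) := ∑ j, (κ + ρ) • l2Diff (e j) with hL
  have hLinner : ∀ f g, inner ℝ (L f) g = ∑ j, (κ + ρ) * inner ℝ (l2Diff (e j) f) g :=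
    fun f g => by
      simp only [hL, sum_apply, sum_inner, smul_apply, inner_smul_left, conj_trivial]
  have hLsymm : ∀ f g, inner ℝ (L f) g = inner ℝ f (L g) := fun f g => by
    rw [real_inner_comm (L g) f, hLinner, hLinner]
    simp only [inner_l2Diff_left _ f, real_inner_comm _ f]
  set D := algebraMap ℝ (ℓ²(G, ℝ) →L[ℝ] ℓ²(G, ℝ)) μ - L with hD
  have hDc : ∀ f, μ * ‖f‖ ^ 2 ≤ inner ℝ (D f) f := fun f => by
    rw [inner_algebraMap_sub_self, hLinner]
    have : ∑ j, (κ + ρ) * inner ℝ (l2Diff (e j) f) f ≤ 0 := Finset.sum_nonpos fun j _ =>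
      mul_nonpos_of_nonneg_of_nonpos (by positivity) (inner_l2Diff_self_nonpos _ _)
    linarith
  obtain ⟨u, hu⟩ := isUnit_of_coercive hμ hDc
  obtain ⟨g, hg⟩ : ∃ g, D g = lp.single 2 0 (1 : ℝ) :=
    ⟨(↑u⁻¹ : ℓ²(G, ℝ) →L[ℝ] ℓ²(G, ℝ)) (lp.single 2 0 (1 : ℝ)), by
      rw [← hu, ← mul_apply_eq_comp, u.mul_inv, one_apply_eq_self]⟩
  have hgin : ∀ f, inner ℝ (D g) f = f 0 := fun f => by rw [hg, l2_inner_single_left]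
  have hg0 : g ≠ 0 := by
    rintro rfl
    have := hgin (lp.single 2 0 (1 : ℝ))
    simp at this
  have hgn : 0 < ‖g‖ ^ 2 := by positivity
  have hgg := hDc g
  rw [hgin] at hgg
  have hs : 0 < g 0 := (mul_pos hμ hgn).trans_le hgg
  refine ⟨g 0, hs, ?_, fun f => ?_⟩
  · rw [lt_div_iff₀ hγ]
    by_contra! hcon
    have h1 := h (l2Tensor g g)
    rw [l2Row_l2Tensor, l2Col_l2Tensor, norm_l2Tensor_sq, norm_smul, mul_pow, Real.norm_eq_abs,
      sq_abs, inner_l2Generator] at h1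
    have h2 : ∑ j, 2 * ‖g‖ ^ 2 * ((κ + ρ) * inner ℝ (l2Diff (e j) g) g) ≤
        ∑ j, (κ * (inner ℝ (l2Diff (e j, (0 : G)) (l2Tensor g g)) (l2Tensor g g)
          + inner ℝ (l2Diff ((0 : G), e j) (l2Tensor g g)) (l2Tensor g g))
          + ρ * inner ℝ (l2Diff (e j, e j) (l2Tensor g g)) (l2Tensor g g)) := by
      refine Finset.sum_le_sum fun j _ => ?_
      rw [inner_l2Diff_l2Tensor, inner_l2Diff_l2Tensor, inner_l2Diff_l2Tensor, inner_l2Diff_self,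
        l2Shift_zero, real_inner_self_eq_norm_sq]
      nlinarith [mul_nonneg hρ (sq_nonneg (inner ℝ (l2Shift (e j) g) g - ‖g‖ ^ 2))]
    rw [← Finset.mul_sum, ← hLinner] at h2
    have h3 := inner_algebraMap_sub_self L μ g
    rw [← hD, hgin] at h3
    have h4 : 0 ≤ ‖g‖ ^ 2 * (g 0 * (g 0 * γ - 1)) :=
      mul_nonneg hgn.le (mul_nonneg hs.le (by linarith))
    nlinarith [mul_pos hμ (mul_pos hgn hgn)]
  · have h1 := inner_map_sq_le (symmetric_algebraMap_sub hLsymm μ)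
      (fun x => (by positivity : 0 ≤ μ * ‖x‖ ^ 2).trans (hDc x)) g (l2RowNorm f)
    rw [← hD, hgin, hgin, l2RowNorm_apply] at h1
    refine h1.trans (mul_le_mul_of_nonneg_left ?_ hs.le)
    rw [inner_algebraMap_sub_self, norm_l2RowNorm_sq, inner_l2Generator, hLinner]
    refine sub_le_sub_left (Finset.sum_le_sum fun j _ => ?_) _
    have h2 := inner_l2Diff_self_le_l2RowNorm (e j) 0 f
    have h3 := inner_l2Diff_self_le_l2RowNorm (e j) (e j) f
    have h4 := inner_l2Diff_self_nonpos (0, e j) f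
    nlinarith

end Lattice

section Resolvent

open scoped lp

variable {G ι : Type*} [AddCommGroup G] [Fintype ι] {e : ι → G} {κ ρ μ : ℝ}
  {r : ℓ²(G × G, ℝ)}

theorem inner_resolvent_coercive (e : ι → G) (hκ : 0 ≤ κ) (hρ : 0 ≤ ρ) (μ : ℝ)
    (f : ℓ²(G × G, ℝ)) :
    μ * ‖f‖ ^ 2 ≤ inner ℝ ((algebraMap ℝ (ℓ²(G × G, ℝ) →L[ℝ] ℓ²(G × G, ℝ)) μ
      - l2Generator e κ ρ) f) f := by
  rw [inner_algebraMap_sub_self]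
  linarith [inner_l2Generator_self_nonpos e hκ hρ f]

theorem resolvent_injective (hκ : 0 ≤ κ) (hρ : 0 ≤ ρ) (hμ : 0 < μ) {f g : ℓ²(G × G, ℝ)}
    (h : (algebraMap ℝ (ℓ²(G × G, ℝ) →L[ℝ] ℓ²(G × G, ℝ)) μ - l2Generator e κ ρ) f
      = (algebraMap ℝ (ℓ²(G × G, ℝ) →L[ℝ] ℓ²(G × G, ℝ)) μ - l2Generator e κ ρ) g) : f = g := by
  have h1 := inner_resolvent_coercive e hκ hρ μ (f - g)
  rw [map_sub, h, sub_self, inner_zero_left] at h1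
  have h2 : ‖f - g‖ ^ 2 ≤ 0 := by nlinarith [sq_nonneg ‖f - g‖]
  exact sub_eq_zero.1 (norm_eq_zero.1 (pow_eq_zero_iff two_ne_zero |>.1
    (le_antisymm h2 (by positivity))))

variable [DecidableEq G]

theorem resolvent_l2Shift
    (hr : (algebraMap ℝ (ℓ²(G × G, ℝ) →L[ℝ] ℓ²(G × G, ℝ)) μ - l2Generator e κ ρ) r
      = lp.single 2 0 (1 : ℝ)) (q : G × G) :
    (algebraMap ℝ (ℓ²(G × G, ℝ) →L[ℝ] ℓ²(G × G, ℝ)) μ - l2Generator e κ ρ) (l2Shift (-q) r)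
      = lp.single 2 q (1 : ℝ) := by
  rw [algebraMap_sub_apply, l2Generator_l2Shift, ← map_smul, ← map_sub, ← algebraMap_sub_apply, hr]
  ext p
  simp [lp.single_apply, Pi.single_apply, ← sub_eq_add_neg, sub_eq_zero]

/-- The value of the resolvent at a point, expressed by its kernel. -/
theorem resolvent_apply {R : ℓ²(G × G, ℝ) →L[ℝ] ℓ²(G × G, ℝ)}
    (hr : (algebraMap ℝ (ℓ²(G × G, ℝ) →L[ℝ] ℓ²(G × G, ℝ)) μ - l2Generator e κ ρ) r
      = lp.single 2 0 (1 : ℝ))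
    (hR : (algebraMap ℝ (ℓ²(G × G, ℝ) →L[ℝ] ℓ²(G × G, ℝ)) μ - l2Generator e κ ρ) * R = 1)
    (p : ℓ²(G × G, ℝ)) (q : G × G) : R p q = inner ℝ (l2Shift (-q) r) p := by
  rw [← l2_inner_single_left q (R p), ← resolvent_l2Shift hr,
    symmetric_algebraMap_sub (inner_l2Generator_left e), ← mul_apply_eq_comp, hR,
    one_apply_eq_self]

theorem resolvent_swap (hκ : 0 ≤ κ) (hρ : 0 ≤ ρ) (hμ : 0 < μ)
    (hr : (algebraMap ℝ (ℓ²(G × G, ℝ) →L[ℝ] ℓ²(G × G, ℝ)) μ - l2Generator e κ ρ) r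
      = lp.single 2 0 (1 : ℝ)) (x y : G) : r (x, y) = r (y, x) := by
  have h : l2Swap r = r := by
    refine resolvent_injective (e := e) hκ hρ hμ ?_
    rw [algebraMap_sub_apply, l2Generator_l2Swap, ← map_smul, ← map_sub, ← algebraMap_sub_apply,
      hr]
    ext ⟨a, b⟩
    simp [lp.single_apply, Pi.single_apply, and_comm]
  conv_lhs => rw [← h]
  rfl

theorem resolvent_nonneg_s13 (hκ : 0 ≤ κ) (hρ : 0 ≤ ρ) (hμ : 0 < μ)
    (hr : (algebraMap ℝ (ℓ²(G × G, ℝ) →L[ℝ] ℓ²(G × G, ℝ)) μ - l2Generator e κ ρ) r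
      = lp.single 2 0 (1 : ℝ)) (q : G × G) : 0 ≤ r q := by
  have h1 := inner_resolvent_coercive e hκ hρ μ (l2Abs r - r)
  have h2 : ∀ f, inner ℝ ((algebraMap ℝ (ℓ²(G × G, ℝ) →L[ℝ] ℓ²(G × G, ℝ)) μ
      - l2Generator e κ ρ) r) f = f 0 := fun f => by rw [hr, l2_inner_single_left]
  have h3 : inner ℝ ((algebraMap ℝ (ℓ²(G × G, ℝ) →L[ℝ] ℓ²(G × G, ℝ)) μ
      - l2Generator e κ ρ) (l2Abs r)) r = |r 0| := by
    rw [symmetric_algebraMap_sub (inner_l2Generator_left e), real_inner_comm, h2, l2Abs_apply]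
  have h4 := inner_l2Generator_self_le_l2Abs e hκ hρ r
  have h5 := h2 r
  have h6 := inner_algebraMap_sub_self (l2Generator e κ ρ) μ (l2Abs r)
  rw [inner_algebraMap_sub_self] at h5
  rw [map_sub, inner_sub_left, inner_sub_right, inner_sub_right, h2, h2, h3, h6, norm_l2Abs,
    l2Abs_apply] at h1
  have h7 : ‖l2Abs r - r‖ ^ 2 ≤ 0 := by
    have := le_abs_self (r 0)
    by_contra! hc
    nlinarith [mul_pos hμ hc]
  have h8 : l2Abs r = r := sub_eq_zero.1 (norm_eq_zero.1 (pow_eq_zero_iff two_ne_zero |>.1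
    (le_antisymm h7 (by positivity))))
  rw [← h8]
  exact abs_nonneg _

theorem resolvent_pos (hκ : 0 < κ) (hρ : 0 ≤ ρ) (hμ : 0 < μ)
    (he : AddSubgroup.closure (Set.range e) = ⊤)
    (hr : (algebraMap ℝ (ℓ²(G × G, ℝ) →L[ℝ] ℓ²(G × G, ℝ)) μ - l2Generator e κ ρ) r
      = lp.single 2 0 (1 : ℝ)) (q : G × G) : 0 < r q := by
  have hnn := resolvent_nonneg_s13 hκ.le hρ hμ hr
  have hzero : ∀ p, r p = 0 → ∀ j, (r (p + (e j, 0)) = 0 ∧ r (p - (e j, 0)) = 0) ∧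
      r (p + (0, e j)) = 0 ∧ r (p - (0, e j)) = 0 := fun p hp j => by
    have h1 := congrArg (fun f : ℓ²(G × G, ℝ) => f p) hr
    simp only [algebraMap_sub_apply, lp.coeFn_sub, lp.coeFn_smul, Pi.sub_apply, Pi.smul_apply, hp,
      smul_zero, zero_sub, l2Generator_apply, l2Diff_apply, mul_zero, sub_zero] at h1
    have h2 : (0 : ℝ) ≤ (lp.single 2 0 (1 : ℝ) : ℓ²(G × G, ℝ)) p := by
      rw [lp.single_apply, Pi.single_apply]
      split_ifs <;> norm_num
    have h3 : ∀ i ∈ Finset.univ, 0 ≤ κ * (r (p + (e i, 0)) + r (p - (e i, 0))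
        + (r (p + (0, e i)) + r (p - (0, e i))))
        + ρ * (r (p + (e i, e i)) + r (p - (e i, e i))) := fun i _ =>
      add_nonneg (mul_nonneg hκ.le (add_nonneg (add_nonneg (hnn _) (hnn _))
        (add_nonneg (hnn _) (hnn _)))) (mul_nonneg hρ (add_nonneg (hnn _) (hnn _)))
    have h4 := (Finset.single_le_sum h3 (Finset.mem_univ j)).trans (by linarith :
      _ ≤ (0 : ℝ))
    have h5 := mul_nonneg hρ (add_nonneg (hnn (p + (e j, e j))) (hnn (p - (e j, e j))))
    have h6 := nonpos_of_mul_nonpos_right (by linarith : κ * (r (p + (e j, 0)) + r (p - (e j, 0))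
        + (r (p + (0, e j)) + r (p - (0, e j)))) ≤ 0) hκ
    have i1 := hnn (p + (e j, 0))
    have i2 := hnn (p - (e j, 0))
    have i3 := hnn (p + (0, e j))
    have i4 := hnn (p - (0, e j))
    refine ⟨⟨?_, ?_⟩, ?_, ?_⟩ <;> linarith
  let N : AddSubgroup (G × G) :=
    { carrier := {a | ∀ p, r p = 0 → r (p + a) = 0 ∧ r (p - a) = 0}
      zero_mem' := fun p hp => by simpa using hp
      add_mem' := fun {a b} ha hb p hp => by
        rw [← add_assoc, ← sub_sub]
        exact ⟨(hb _ (ha p hp).1).1, (hb _ (ha p hp).2).2⟩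
      neg_mem' := fun {a} ha p hp => by
        rw [← sub_eq_add_neg, sub_neg_eq_add]
        exact (ha p hp).symm }
  have hN1 : N.comap (AddMonoidHom.inl G G) = ⊤ := by
    rw [eq_top_iff, ← he, AddSubgroup.closure_le]
    rintro _ ⟨j, rfl⟩ p hp
    exact (hzero p hp j).1
  have hN2 : N.comap (AddMonoidHom.inr G G) = ⊤ := by
    rw [eq_top_iff, ← he, AddSubgroup.closure_le]
    rintro _ ⟨j, rfl⟩ p hp
    exact (hzero p hp j).2
  have hN : ∀ a, a ∈ N := fun a => by
    have h1 : a.1 ∈ N.comap (AddMonoidHom.inl G G) := hN1 ▸ AddSubgroup.mem_top _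
    have h2 : a.2 ∈ N.comap (AddMonoidHom.inr G G) := hN2 ▸ AddSubgroup.mem_top _
    simpa using N.add_mem h1 h2
  refine (hnn q).lt_of_ne' fun hq => ?_
  have h0 : r = 0 := by
    ext p
    simpa using (hN (p - q) q hq).1
  rw [h0, map_zero] at hr
  have := congrArg (fun f : ℓ²(G × G, ℝ) => f 0) hr
  simp at this

end Resolvent

section Lattice

open scoped lp

theorem inner_indicator_axes {G : Type*} [AddCommGroup G] [DecidableEq G]
    {V : ℓ²(G × G, ℝ) →L[ℝ] ℓ²(G × G, ℝ)}
    (hV : ∀ f q, V f q = ((if q.1 = 0 then (1 : ℝ) else 0)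
      + (if q.2 = 0 then (1 : ℝ) else 0)) * f q)
    (f g : ℓ²(G × G, ℝ)) :
    inner ℝ (V f) g = inner ℝ (l2Row 0 f) (l2Row 0 g) + inner ℝ (l2Col 0 f) (l2Col 0 g) := by
  have h1 : HasSum (fun q : G × G => if q.1 = 0 then f q * g q else 0)
      (inner ℝ (l2Row 0 f) (l2Row 0 g)) := by
    refine (Function.Injective.hasSum_iff (Prod.mk_right_injective (0 : G)) ?_).1 ?_
    · rintro ⟨x, y⟩ hq
      exact if_neg fun h : x = 0 => hq ⟨y, congrArg (·, y) h.symm⟩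
    · simpa [Function.comp_def] using l2_hasSum_inner (l2Row 0 f) (l2Row 0 g)
  have h2 : HasSum (fun q : G × G => if q.2 = 0 then f q * g q else 0)
      (inner ℝ (l2Col 0 f) (l2Col 0 g)) := by
    refine (Function.Injective.hasSum_iff (Prod.mk_left_injective (0 : G)) ?_).1 ?_
    · rintro ⟨x, y⟩ hq
      exact if_neg fun h : y = 0 => hq ⟨x, congrArg (x, ·) h.symm⟩
    · simpa [Function.comp_def] using l2_hasSum_inner (l2Col 0 f) (l2Col 0 g)
  have h3 : (fun q => V f q * g q) = fun q => (if q.1 = 0 then f q * g q else 0)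
      + if q.2 = 0 then f q * g q else 0 := by
    ext q
    rw [hV]
    split_ifs <;> ring
  have h4 := l2_hasSum_inner (V f) g
  rw [h3] at h4
  exact h4.unique (h1.add h2)

theorem closure_range_single_one {ι : Type*} [Fintype ι] [DecidableEq ι] :
    AddSubgroup.closure (Set.range fun j : ι => (Pi.single j 1 : ι → ℤ)) = ⊤ := by
  refine eq_top_iff.2 fun x _ => ?_
  rw [← Finset.univ_sum_single x]
  refine AddSubgroup.sum_mem _ fun j _ => ?_
  have : (Pi.single j (x j) : ι → ℤ) = x j • Pi.single j 1 := by
    rw [← Pi.single_smul, smul_eq_mul, mul_one]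
  rw [this]
  refine AddSubgroup.zsmul_mem _ (AddSubgroup.subset_closure ?_) _
  exact Set.mem_range_self j

instance nontrivial_l2 {α : Type*} [Nonempty α] : Nontrivial ℓ²(α, ℝ) := by
  classical
  obtain ⟨x⟩ := ‹Nonempty α›
  refine ⟨⟨lp.single 2 x (1 : ℝ), 0, fun h => ?_⟩⟩
  have := congrArg (fun f : ℓ²(α, ℝ) => f x) h
  simp at this

/-- An operator with positive kernel maps nonzero nonnegative families to positive ones. -/
theorem map_l2Abs_pos {α : Type*} {T : ℓ²(α, ℝ) →L[ℝ] ℓ²(α, ℝ)} {k : α → ℓ²(α, ℝ)}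
    (hT : ∀ v x, T v x = inner ℝ (k x) v) (hk : ∀ x y, 0 < k x y) {v : ℓ²(α, ℝ)} (hv : v ≠ 0)
    (x : α) : 0 < T (l2Abs v) x := by
  obtain ⟨y, hy⟩ : ∃ y, v y ≠ 0 := by
    by_contra! h
    exact hv (by ext y; exact h y)
  have hs := l2_hasSum_inner (k x) (l2Abs v)
  rw [hT, ← hs.tsum_eq]
  exact hs.summable.tsum_pos (fun z => mul_nonneg (hk x z).le (abs_nonneg _)) y
    (mul_pos (hk x y) (abs_pos.2 hy))

end Lattice

section PrincipalEigenfunction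

open scoped lp

variable {G ι : Type*} [AddCommGroup G] [DecidableEq G] [Fintype ι] {e : ι → G} {κ ρ γ μ : ℝ}
  {r : ℓ²(G × G, ℝ)} {T₁ T₂ : ℓ²(G, ℝ) →L[ℝ] ℓ²(G, ℝ)}

/-- The sandwiches of the resolvent between restrictions to the axes and their adjoints. -/
theorem resolvent_sandwich {R : ℓ²(G × G, ℝ) →L[ℝ] ℓ²(G × G, ℝ)}
    (hswap : ∀ x y, r (x, y) = r (y, x))
    (hr : (algebraMap ℝ (ℓ²(G × G, ℝ) →L[ℝ] ℓ²(G × G, ℝ)) μ - l2Generator e κ ρ) r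
      = lp.single 2 0 (1 : ℝ))
    (hR : (algebraMap ℝ (ℓ²(G × G, ℝ) →L[ℝ] ℓ²(G × G, ℝ)) μ - l2Generator e κ ρ) * R = 1)
    (hT₁ : ∀ v x, T₁ v x = inner ℝ (l2Row (-x) r) v)
    (hT₂ : ∀ v x, T₂ v x = inner ℝ (l2Shift (-x) (l2Col 0 r)) v) :
    l2Row 0 ∘L R ∘L ContinuousLinearMap.adjoint (l2Row 0) = T₂ ∧
    l2Row 0 ∘L R ∘L ContinuousLinearMap.adjoint (l2Col 0) = T₁ ∧
    l2Col 0 ∘L R ∘L ContinuousLinearMap.adjoint (l2Row 0) = T₁ ∧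
    l2Col 0 ∘L R ∘L ContinuousLinearMap.adjoint (l2Col 0) = T₂ := by
  have hkernel : ∀ (B : ℓ²(G × G, ℝ) →L[ℝ] ℓ²(G, ℝ)) v q,
      R (ContinuousLinearMap.adjoint B v) q = inner ℝ (B (l2Shift (-q) r)) v := fun B v q => by
    rw [resolvent_apply hr hR, ContinuousLinearMap.adjoint_inner_right]
  refine ⟨?_, ?_, ?_, ?_⟩ <;> ext v x
  · rw [hT₂]
    refine (hkernel _ v (0, x)).trans (congrArg (inner ℝ · v) ?_)
    ext y
    exact (congrArg r (by simp)).trans (hswap 0 (y + -x))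
  · rw [hT₁]
    refine (hkernel _ v (0, x)).trans (congrArg (inner ℝ · v) ?_)
    ext y
    exact (congrArg r (by simp)).trans (hswap y (-x))
  · rw [hT₁]
    refine (hkernel _ v (x, 0)).trans (congrArg (inner ℝ · v) ?_)
    ext y
    exact congrArg r (by simp)
  · rw [hT₂]
    refine (hkernel _ v (x, 0)).trans (congrArg (inner ℝ · v) ?_)
    ext y
    exact congrArg r (by simp)

/-- The top of the spectrum of `T₁ + T₂` is `1 / γ`, an isolated eigenvalue with a strictly positive
eigenfunction, when `μ` is the top of the spectrum of the generator plus `γ` times the sum of the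
indicators of the axes. -/
theorem principal_eigenfunction_of_generator (he : AddSubgroup.closure (Set.range e) = ⊤)
    (hκ : 0 < κ) (hρ : 0 ≤ ρ) (hγ : 0 < γ) {V : ℓ²(G × G, ℝ) →L[ℝ] ℓ²(G × G, ℝ)}
    (hV : ∀ f q, V f q = ((if q.1 = 0 then (1 : ℝ) else 0)
      + (if q.2 = 0 then (1 : ℝ) else 0)) * f q)
    (hμ : sSup (spectrum ℝ (l2Generator e κ ρ + γ • V)) = μ) (hμ0 : 0 < μ)
    (hr : (algebraMap ℝ (ℓ²(G × G, ℝ) →L[ℝ] ℓ²(G × G, ℝ)) μ - l2Generator e κ ρ) r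
      = lp.single 2 0 (1 : ℝ))
    (hT₁ : ∀ v x, T₁ v x = inner ℝ (l2Row (-x) r) v)
    (hT₂ : ∀ v x, T₂ v x = inner ℝ (l2Shift (-x) (l2Col 0 r)) v) :
    1 / γ = sSup (spectrum ℝ (T₁ + T₂)) ∧
    (∃ v : ℓ²(G, ℝ), (∀ x, 0 < v x) ∧ (T₁ + T₂) v = (1 / γ) • v) ∧
    ∃ δ : ℝ, 0 < δ ∧ spectrum ℝ (T₁ + T₂) ∩ Set.Ioo (1 / γ - δ) (1 / γ + δ) = {1 / γ} := by
  have hVf := inner_indicator_axes hV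
  have hDc := inner_resolvent_coercive e hκ.le hρ μ
  have hDsymm := symmetric_algebraMap_sub (inner_l2Generator_left (κ := κ) (ρ := ρ) e) μ
  obtain ⟨u, hu⟩ := isUnit_of_coercive hμ0 hDc
  obtain ⟨R, hDR⟩ : ∃ R, (algebraMap ℝ _ μ - l2Generator e κ ρ) * R = 1 :=
    ⟨_, hu ▸ u.mul_inv⟩
  have hH : ∀ x y, inner ℝ ((l2Generator e κ ρ + γ • V) x) y
      = μ * inner ℝ x y - inner ℝ ((algebraMap ℝ _ μ - l2Generator e κ ρ) x) y
        + γ * (inner ℝ (l2Row 0 x) (l2Row 0 y) + inner ℝ (l2Col 0 x) (l2Col 0 y)) :=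
    fun x y => by
      rw [algebraMap_sub_apply, inner_sub_left, inner_smul_left, add_apply, smul_apply,
        inner_add_left, inner_smul_left, hVf, conj_trivial, conj_trivial]
      ring
  have hHsymm : ∀ x y, inner ℝ ((l2Generator e κ ρ + γ • V) x) y
      = inner ℝ x ((l2Generator e κ ρ + γ • V) y) := fun x y => by
    rw [← real_inner_comm x, hH, hH, hDsymm]
    simp only [real_inner_comm]
  obtain ⟨s, hs0, hsγ, hs⟩ := exists_form_bound_l2Row_zero e hκ.le hρ hγ hμ0 fun f => by
    have := (sSup_spectrum_of_symmetric hHsymm).2.1 f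
    rw [hμ] at this
    rwa [add_apply, smul_apply, inner_add_left, inner_smul_left, hVf, conj_trivial,
      real_inner_self_eq_norm_sq, real_inner_self_eq_norm_sq] at this
  have hpos := resolvent_pos hκ hρ hμ0 he hr
  have hswap := resolvent_swap hκ.le hρ hμ0 hr
  have hT : ∀ v x, (T₁ + T₂) v x = inner ℝ (l2Row (-x) r + l2Shift (-x) (l2Col 0 r)) v :=
    fun v x => by
      rw [inner_add_left, ← hT₁, ← hT₂]
      rfl
  have hk : ∀ x y, 0 < (l2Row (-x) r + l2Shift (-x) (l2Col 0 r)) y := fun x y =>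
    add_pos (hpos _) (hpos _)
  obtain ⟨h11, h12, h21, h22⟩ := resolvent_sandwich hswap hr hDR hT₁ hT₂
  have habs1 := abs_inner_map_self_le_l2Abs hT₁ fun x y => (hpos _).le
  have habs2 := abs_inner_map_self_le_l2Abs hT₂ fun x y => (hpos _).le
  have habs := abs_inner_map_self_le_l2Abs hT fun x y => (hk x y).le
  obtain ⟨hTsymm, hTsq, hTsup⟩ := birmanSchwinger hDsymm hγ hμ0 hDc hDR hH hμ h11 h12 h21
    h22 fun v => ⟨l2Abs v, norm_l2Abs v, by
      rw [add_apply, inner_add_left]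
      linarith [neg_le_abs (inner ℝ (T₁ v) v), le_abs_self (inner ℝ (T₂ v) v), habs1 v, habs2 v]⟩
  have hT2sq : ∀ v, ‖T₂ v‖ ^ 2 ≤ s * inner ℝ (T₂ v) v := by
    rw [← h11]
    exact norm_sq_le_of_form_bound hDR fun f => by
      rw [inner_algebraMap_sub_self]
      exact hs f
  have hT2s := inner_map_self_le_of_norm_sq_le hs0 hT2sq
  have hrows : Summable fun x => ‖l2Row (-x) r‖ ^ 2 :=
    (hasSum_norm_l2Row_sq r).summable.comp_injective neg_injective
  have hcompact := isCompactOperator_of_summable_rows hT₁ hrows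
  have hmem := (sSup_spectrum_of_symmetric hTsymm).1
  rw [hTsup] at hmem
  obtain ⟨v, hv, hTv⟩ := exists_eigenvector_of_mem_spectrum hcompact hTsymm hT2s hsγ hmem
  have hray := (le_abs_self _).trans (habs v)
  rw [hTv, inner_smul_left, real_inner_self_eq_norm_sq, ← norm_l2Abs v, conj_trivial] at hray
  have hTw := eigenvector_of_rayleigh (one_div_pos.2 hγ).le hTsq hray
  have hiso := exists_isolated_of_mem_spectrum hcompact hTsymm hT2s hsγ hmem
  refine ⟨hTsup.symm, ⟨l2Abs v, fun x => ?_, hTw⟩, hiso⟩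
  have h1 := map_l2Abs_pos hT hk (norm_ne_zero_iff.1 (hv ▸ one_ne_zero)) x
  rw [hTw] at h1
  exact pos_of_mul_pos_right h1 (by positivity)

end PrincipalEigenfunction

/-- Suppose `γ > 0` and `λ₂ := sup σ(H²) > 0`, where
`H² = A² + γV²` on `ℓ²(ℤ^d × ℤ^d)`. Then the operator `T_{λ₂} = T⁽¹⁾ + T⁽²⁾` on
`ℓ²(ℤ^d)`, built from the resolvent kernel `r²_{λ₂} = (λ₂ − A²)⁻¹δ_{(0,0)}`,
satisfies: `1/γ = sup σ(T_{λ₂})`; there is a strictly positive `ṽ ∈ ℓ²(ℤ^d)` with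
`T_{λ₂} ṽ = (1/γ) ṽ`; and `1/γ` is isolated in `σ(T_{λ₂})`. -/
theorem principal_eigenfunction_T_lambda2
    (d : ℕ) (hd : 1 ≤ d)
    (κ ρ γ : ℝ) (hκ : 0 < κ) (hρ : 0 < ρ) (hγ : 0 < γ)
    (A2 : lp (fun _ : (Fin d → ℤ) × (Fin d → ℤ) => ℝ) 2 →L[ℝ]
      lp (fun _ : (Fin d → ℤ) × (Fin d → ℤ) => ℝ) 2)
    (hA2 : ∀ (f : lp (fun _ : (Fin d → ℤ) × (Fin d → ℤ) => ℝ) 2)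
        (q : (Fin d → ℤ) × (Fin d → ℤ)),
      A2 f q = κ * (∑ j : Fin d,
          ((f (q.1 + Pi.single j 1, q.2) - f q) + (f (q.1 - Pi.single j 1, q.2) - f q)
            + (f (q.1, q.2 + Pi.single j 1) - f q) + (f (q.1, q.2 - Pi.single j 1) - f q)))
        + ρ * (∑ j : Fin d,
          ((f (q.1 + Pi.single j 1, q.2 + Pi.single j 1) - f q)
            + (f (q.1 - Pi.single j 1, q.2 - Pi.single j 1) - f q))))
    (V2 : lp (fun _ : (Fin d → ℤ) × (Fin d → ℤ) => ℝ) 2 →L[ℝ]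
      lp (fun _ : (Fin d → ℤ) × (Fin d → ℤ) => ℝ) 2)
    (hV2 : ∀ (f : lp (fun _ : (Fin d → ℤ) × (Fin d → ℤ) => ℝ) 2)
        (q : (Fin d → ℤ) × (Fin d → ℤ)),
      V2 f q = ((if q.1 = 0 then (1:ℝ) else 0) + (if q.2 = 0 then (1:ℝ) else 0)) * f q)
    (hlam : 0 < sSup (spectrum ℝ (A2 + γ • V2)))
    (δ00 : lp (fun _ : (Fin d → ℤ) × (Fin d → ℤ) => ℝ) 2)
    (hδ00 : ∀ q : (Fin d → ℤ) × (Fin d → ℤ), δ00 q = if q = 0 then 1 else 0)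
    (r : lp (fun _ : (Fin d → ℤ) × (Fin d → ℤ) => ℝ) 2)
    (hr : (sSup (spectrum ℝ (A2 + γ • V2)) •
        (1 : lp (fun _ : (Fin d → ℤ) × (Fin d → ℤ) => ℝ) 2 →L[ℝ]
          lp (fun _ : (Fin d → ℤ) × (Fin d → ℤ) => ℝ) 2) - A2) r = δ00)
    (T1 T2 : lp (fun _ : Fin d → ℤ => ℝ) 2 →L[ℝ] lp (fun _ : Fin d → ℤ => ℝ) 2)
    (hT1 : ∀ (f : lp (fun _ : Fin d → ℤ => ℝ) 2) (x : Fin d → ℤ),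
      T1 f x = ∑' y : Fin d → ℤ, r (-x, y) * f y)
    (hT2 : ∀ (f : lp (fun _ : Fin d → ℤ => ℝ) 2) (x : Fin d → ℤ),
      T2 f x = ∑' y : Fin d → ℤ, r (y - x, 0) * f y) :
    1 / γ = sSup (spectrum ℝ (T1 + T2)) ∧
    (∃ v : lp (fun _ : Fin d → ℤ => ℝ) 2,
      (∀ x : Fin d → ℤ, 0 < v x) ∧ (T1 + T2) v = (1 / γ) • v) ∧
    ∃ δ : ℝ, 0 < δ ∧
      spectrum ℝ (T1 + T2) ∩ Set.Ioo (1 / γ - δ) (1 / γ + δ) = {1 / γ} := by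
  have hA : A2 = l2Generator (fun j : Fin d => (Pi.single j 1 : Fin d → ℤ)) κ ρ := by
    ext f q
    rw [hA2, l2Generator_apply, Finset.mul_sum, Finset.mul_sum, ← Finset.sum_add_distrib]
    refine Finset.sum_congr rfl fun j _ => ?_
    obtain ⟨x, y⟩ := q
    simp only [l2Diff_apply, Prod.mk_add_mk, Prod.mk_sub_mk, add_zero, sub_zero]
    ring
  have hδ : δ00 = lp.single 2 0 (1 : ℝ) := by
    ext q
    rw [hδ00, lp.single_apply, Pi.single_apply]
  subst hA hδ
  rw [← Algebra.algebraMap_eq_smul_one] at hr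
  refine principal_eigenfunction_of_generator closure_range_single_one hκ hρ.le hγ hV2 rfl hlam hr
    (fun v x => (hT1 v x).trans (l2_hasSum_inner (l2Row (-x) r) v).tsum_eq) fun v x => ?_
  rw [hT2, ← (l2_hasSum_inner (l2Shift (-x) (l2Col 0 r)) v).tsum_eq]
  simp only [l2Shift_apply, l2Col_apply, sub_eq_add_neg]
end

section
/- For γ > 0 and every x ∈ ℤ^{pd}, the semigroup applied to the indicator of the growing box approximates the semigroup applied to the constant function 1: (exp(t H^p_∞) 1_{Q_{t²}})(x) ~ (exp(t H^p_∞) 𝟙)(x) as t → ∞, i.e. their ratio tends to 1, where Q_s := ℤ^{pd} ∩ [−s, s]^{pd}. -/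
open Filter Topology BoundedContinuousFunction

/-- A solution of `u' = H u` on a Banach space is given pointwise by the exponential series. -/
lemma hasSum_of_hasDerivAt_clm {E : Type*} [NormedAddCommGroup E] [NormedSpace ℝ E]
    [CompleteSpace E] (H : E →L[ℝ] E) (u : ℝ → E) (hu : ∀ t, HasDerivAt u (H (u t)) t) (t : ℝ) :
    HasSum (fun n : ℕ => (t ^ n / (n.factorial : ℝ)) • (H ^ n) (u 0)) (u t) := by
  have hexp : ∀ s : ℝ, HasDerivAt (fun s : ℝ => NormedSpace.exp (s • H) (u 0))
      (H (NormedSpace.exp (s • H) (u 0))) s := by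
    intro s
    have h := (hasDerivAt_exp_smul_const' (𝕂 := ℝ) H s).clm_apply (hasDerivAt_const s (u 0))
    simpa using h
  have huniq : u = fun s : ℝ => NormedSpace.exp (s • H) (u 0) :=
    ODE_solution_unique_univ (v := fun _ => H) (s := fun _ => Set.univ) (K := ‖H‖₊) (t₀ := 0)
      (fun _ => H.lipschitz.lipschitzOnWith) (fun s => ⟨hu s, Set.mem_univ _⟩)
      (fun s => ⟨hexp s, Set.mem_univ _⟩) (by simp)
  have hs := NormedSpace.exp_series_hasSum_exp' (𝕂 := ℝ) (t • H)
  have hs' := hs.mapL (ContinuousLinearMap.apply ℝ E (u 0))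
  rw [congrFun huniq t]
  convert hs' using 2 with n
  · simp [smul_pow, smul_smul, div_eq_inv_mul]
  · rfl

/-- Evaluation of the exponential series of a solution in `ℓ^∞` at a point. -/
lemma hasSum_apply_of_hasDerivAt_clm {X : Type*} [TopologicalSpace X]
    (H : (X →ᵇ ℝ) →L[ℝ] (X →ᵇ ℝ)) (u : ℝ → (X →ᵇ ℝ))
    (hu : ∀ t, HasDerivAt u (H (u t)) t) (t : ℝ) (x : X) :
    HasSum (fun n : ℕ => t ^ n / (n.factorial : ℝ) * (H ^ n) (u 0) x) (u t x) := by
  simpa using (hasSum_of_hasDerivAt_clm H u hu t).mapL (BoundedContinuousFunction.evalCLM ℝ x)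

/-- If `H + c` maps functions bounded below by `a ≥ 0` to functions bounded below by `c a`,
then the semigroup generated by `H` maps `1` to functions bounded below by `1`. -/
lemma one_le_of_hasDerivAt_clm {X : Type*} [TopologicalSpace X]
    (H : (X →ᵇ ℝ) →L[ℝ] (X →ᵇ ℝ)) (c : ℝ) (hc : 0 ≤ c)
    (hH : ∀ (f : X →ᵇ ℝ) (a : ℝ), 0 ≤ a → (∀ y, a ≤ f y) → ∀ y, c * a ≤ H f y + c * f y)
    (u : ℝ → (X →ᵇ ℝ)) (hu0 : u 0 = 1) (hu : ∀ t, HasDerivAt u (H (u t)) t)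
    {t : ℝ} (ht : 0 ≤ t) (x : X) : 1 ≤ u t x := by
  set B : (X →ᵇ ℝ) →L[ℝ] (X →ᵇ ℝ) := H + c • ContinuousLinearMap.id ℝ _ with hB
  have hv : ∀ s, HasDerivAt (fun s : ℝ => Real.exp (c * s) • u s)
      (B (Real.exp (c * s) • u s)) s := by
    intro s
    have h1 : HasDerivAt (fun s : ℝ => Real.exp (c * s)) (Real.exp (c * s) * c) s := by
      simpa using ((hasDerivAt_id s).const_mul c).exp
    refine (h1.smul (hu s)).congr_deriv ?_
    simp [hB, smul_smul, mul_comm]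
  have hpow : ∀ n : ℕ, ∀ y, c ^ n ≤ (B ^ n) 1 y := by
    intro n
    induction n with
    | zero => intro y; simp
    | succ k ih =>
      intro y
      have h := hH ((B ^ k) 1) (c ^ k) (pow_nonneg hc k) ih y
      rw [pow_succ' B, pow_succ' c]
      simpa [hB] using h
  have hsum := hasSum_apply_of_hasDerivAt_clm B _ hv t x
  have hexp : HasSum (fun n : ℕ => t ^ n / (n.factorial : ℝ) * c ^ n) (Real.exp (c * t)) := by
    have heq : (fun n : ℕ => t ^ n / (n.factorial : ℝ) * c ^ n) =
        fun n : ℕ => (c * t) ^ n / (n.factorial : ℝ) := by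
      funext n
      rw [mul_pow]; ring
    rw [heq, Real.exp_eq_exp_ℝ]
    exact NormedSpace.expSeries_div_hasSum_exp _
  have hle : Real.exp (c * t) ≤ Real.exp (c * t) * u t x := by
    refine hasSum_le (fun n => ?_) hexp hsum
    have h := hpow n x
    simp only [mul_zero, Real.exp_zero, one_smul, hu0]
    gcongr
  exact le_of_mul_le_mul_left (by simpa using hle) (Real.exp_pos (c * t))

/-- Exponential smallness at a point `x` of a solution of `w' = H w` when the first iterates of
the initial datum vanish at `x`. -/
lemma abs_le_of_iterates_vanish {X : Type*} [TopologicalSpace X]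
    (H : (X →ᵇ ℝ) →L[ℝ] (X →ᵇ ℝ)) (w : ℝ → (X →ᵇ ℝ)) (hw : ∀ t, HasDerivAt w (H (w t)) t)
    (hw0 : ‖w 0‖ ≤ 1) (x : X) (r : ℝ) (hvan : ∀ n : ℕ, (n : ℝ) ≤ r → (H ^ n) (w 0) x = 0)
    {t : ℝ} (ht : 0 ≤ t) :
    |w t x| ≤ Real.exp (Real.exp 1 * ‖H‖ * t - r) := by
  have hsum := hasSum_apply_of_hasDerivAt_clm H w hw t x
  have hexp : HasSum (fun n : ℕ => Real.exp (-r) *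
      ((Real.exp 1 * ‖H‖ * t) ^ n / (n.factorial : ℝ)))
      (Real.exp (Real.exp 1 * ‖H‖ * t - r)) := by
    rw [sub_eq_add_neg, add_comm, Real.exp_add]
    refine HasSum.mul_left _ ?_
    rw [Real.exp_eq_exp_ℝ]
    exact NormedSpace.expSeries_div_hasSum_exp _
  rw [← Real.norm_eq_abs, ← hsum.tsum_eq]
  refine tsum_of_norm_bounded hexp (fun n => ?_)
  by_cases hn : (n : ℝ) ≤ r
  · rw [hvan n hn, mul_zero, norm_zero]
    positivity
  · have h1 : ‖(H ^ n) (w 0) x‖ ≤ ‖H‖ ^ n := by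
      calc ‖(H ^ n) (w 0) x‖ ≤ ‖(H ^ n) (w 0)‖ := BoundedContinuousFunction.norm_coe_le_norm _ x
        _ ≤ ‖H ^ n‖ * ‖w 0‖ := (H ^ n).le_opNorm _
        _ ≤ ‖H ^ n‖ * 1 := by gcongr
        _ ≤ ‖H‖ ^ n := by
          rw [mul_one]
          rcases Nat.eq_zero_or_pos n with h | h
          · subst h
            simpa [ContinuousLinearMap.one_def] using
              ContinuousLinearMap.norm_id_le (𝕜 := ℝ) (E := X →ᵇ ℝ)
          · exact norm_pow_le' H h
    have h2 : 1 ≤ Real.exp (-r) * Real.exp 1 ^ n := by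
      rw [← Real.exp_nat_mul, ← Real.exp_add]
      exact Real.one_le_exp (by push Not at hn; linarith)
    calc ‖t ^ n / (n.factorial : ℝ) * (H ^ n) (w 0) x‖
        = t ^ n / (n.factorial : ℝ) * ‖(H ^ n) (w 0) x‖ := by
          rw [norm_mul, Real.norm_of_nonneg (by positivity)]
      _ ≤ t ^ n / (n.factorial : ℝ) * ‖H‖ ^ n := by gcongr
      _ ≤ (Real.exp (-r) * Real.exp 1 ^ n) * (t ^ n / (n.factorial : ℝ) * ‖H‖ ^ n) :=
          le_mul_of_one_le_left (by positivity) h2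
      _ = _ := by rw [mul_pow, mul_pow]; ring

/-- An operator on `ℓ^∞` of a lattice with range one propagates the vanishing of a function on a
box to slightly smaller boxes. -/
lemma pow_apply_eq_zero_of_range_one {d p : ℕ}
    (H : ((Fin p → Fin d → ℤ) →ᵇ ℝ) →L[ℝ] ((Fin p → Fin d → ℤ) →ᵇ ℝ))
    (hH : ∀ (f : (Fin p → Fin d → ℤ) →ᵇ ℝ) (y : Fin p → Fin d → ℤ),
      (∀ z : Fin p → Fin d → ℤ, (∀ i j, |z i j - y i j| ≤ 1) → f z = 0) → H f y = 0)
    (f : (Fin p → Fin d → ℤ) →ᵇ ℝ) (r : ℝ)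
    (hf : ∀ y : Fin p → Fin d → ℤ, (∀ i j, |(y i j : ℝ)| ≤ r) → f y = 0) (n : ℕ) :
    ∀ y : Fin p → Fin d → ℤ, (∀ i j, |(y i j : ℝ)| ≤ r - n) → (H ^ n) f y = 0 := by
  induction n with
  | zero => simpa using hf
  | succ k ih =>
    intro y hy
    rw [pow_succ']
    refine hH _ y (fun z hz => ih z (fun i j => ?_))
    have h1 : |(z i j : ℝ) - y i j| ≤ 1 := by exact_mod_cast hz i j
    have h2 := hy i j
    push_cast at h2
    have h3 := abs_add_le ((z i j : ℝ) - y i j) (y i j)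
    rw [sub_add_cancel] at h3
    linarith

/-- For `γ > 0` and every `x ∈ ℤ^{pd}`, the moment semigroup
`exp(t H^p_∞)` of the parabolic Anderson model viewed from the catalyst, applied
to the indicator of the growing box `Q_{t²} = ℤ^{pd} ∩ [−t², t²]^{pd}`,
approximates the semigroup applied to the constant function `𝟙`:
`(exp(t H^p_∞) 1_{Q_{t²}})(x) / (exp(t H^p_∞) 𝟙)(x) → 1` as `t → ∞`.
Here `t ↦ exp(t H^p_∞) f` is encoded as the (unique, since `H^p_∞` is bounded)
solution of `w' = H^p_∞ w`, `w 0 = f` on `ℓ^∞(ℤ^{pd})`. -/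
theorem box_approximation_of_moments
    (d p : ℕ) (hd : 1 ≤ d) (hp : 1 ≤ p)
    (κ ρ γ : ℝ) (hκ : 0 < κ) (hρ : 0 < ρ) (hγ : 0 < γ)
    (Hinf : ((Fin p → Fin d → ℤ) →ᵇ ℝ) →L[ℝ] ((Fin p → Fin d → ℤ) →ᵇ ℝ))
    (hHinf : ∀ (f : (Fin p → Fin d → ℤ) →ᵇ ℝ) (x : Fin p → Fin d → ℤ),
      Hinf f x = κ * (∑ i : Fin p, ∑ j : Fin d,
          ((f (Function.update x i (x i + Pi.single j 1)) - f x)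
            + (f (Function.update x i (x i - Pi.single j 1)) - f x)))
        + ρ * (∑ j : Fin d,
          ((f (fun i => x i + Pi.single j 1) - f x)
            + (f (fun i => x i - Pi.single j 1) - f x)))
        + γ * ((∑ i : Fin p, if x i = 0 then (1:ℝ) else 0) * f x))
    (ind : ℝ → ((Fin p → Fin d → ℤ) →ᵇ ℝ))
    (hind : ∀ (s : ℝ) (x : Fin p → Fin d → ℤ),
      ind s x = Set.indicator {y : Fin p → Fin d → ℤ | ∀ i j, |(y i j : ℝ)| ≤ s}
        (fun _ => (1:ℝ)) x)
    (u : ℝ → ((Fin p → Fin d → ℤ) →ᵇ ℝ)) (hu0 : u 0 = 1)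
    (hu : ∀ t : ℝ, HasDerivAt u (Hinf (u t)) t)
    (W : ℝ → ℝ → ((Fin p → Fin d → ℤ) →ᵇ ℝ))
    (hW0 : ∀ s : ℝ, W s 0 = ind s)
    (hW : ∀ (s t : ℝ), HasDerivAt (W s) (Hinf (W s t)) t)
    (x : Fin p → Fin d → ℤ) :
    Tendsto (fun t : ℝ => W (t ^ 2) t x / u t x) atTop (𝓝 1) := by
  have hsingle : ∀ (j j' : Fin d), |(Pi.single j 1 : Fin d → ℤ) j'| ≤ 1 := by
    intro j j'
    by_cases h : j' = j
    · subst h; simp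
    · simp [Pi.single_eq_of_ne h]
  have hrange : ∀ (f : (Fin p → Fin d → ℤ) →ᵇ ℝ) (y : Fin p → Fin d → ℤ),
      (∀ z : Fin p → Fin d → ℤ, (∀ i j, |z i j - y i j| ≤ 1) → f z = 0) → Hinf f y = 0 := by
    intro f y hf
    have h0 : f y = 0 := hf y (by simp)
    have h1 : ∀ i j, f (Function.update y i (y i + Pi.single j 1)) = 0 := by
      intro i j
      refine hf _ (fun i' j' => ?_)
      by_cases h : i' = i
      · subst h; simpa using hsingle j j'
      · simp [Function.update_of_ne h]
    have h2 : ∀ i j, f (Function.update y i (y i - Pi.single j 1)) = 0 := by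
      intro i j
      refine hf _ (fun i' j' => ?_)
      by_cases h : i' = i
      · subst h; simpa using hsingle j j'
      · simp [Function.update_of_ne h]
    have h3 : ∀ j, f (fun i => y i + Pi.single j 1) = 0 :=
      fun j => hf _ (fun i' j' => by simpa using hsingle j j')
    have h4 : ∀ j, f (fun i => y i - Pi.single j 1) = 0 :=
      fun j => hf _ (fun i' j' => by simpa using hsingle j j')
    simp [hHinf, h0, h1, h2, h3, h4]
  have hu1 : ∀ t : ℝ, 0 ≤ t → 1 ≤ u t x := by
    intro t ht
    refine one_le_of_hasDerivAt_clm Hinf (κ * (p * (d * 2)) + ρ * (d * 2)) (by positivity)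
      ?_ u hu0 hu ht x
    intro f a ha hf y
    have h1 : ∑ _i : Fin p, ∑ _j : Fin d, (2 * a - 2 * f y) ≤
        ∑ i : Fin p, ∑ j : Fin d, ((f (Function.update y i (y i + Pi.single j 1)) - f y)
            + (f (Function.update y i (y i - Pi.single j 1)) - f y)) := by
      gcongr with i _ j _
      linarith [hf (Function.update y i (y i + Pi.single j 1)),
        hf (Function.update y i (y i - Pi.single j 1))]
    have h2 : ∑ _j : Fin d, (2 * a - 2 * f y) ≤
        ∑ j : Fin d, ((f (fun i => y i + Pi.single j 1) - f y)
            + (f (fun i => y i - Pi.single j 1) - f y)) := by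
      gcongr with j _
      linarith [hf (fun i => y i + Pi.single j 1), hf (fun i => y i - Pi.single j 1)]
    have h3 : 0 ≤ γ * ((∑ i : Fin p, if y i = 0 then (1:ℝ) else 0) * f y) := by
      have : 0 ≤ f y := ha.trans (hf y)
      positivity
    have h1' := mul_le_mul_of_nonneg_left h1 hκ.le
    have h2' := mul_le_mul_of_nonneg_left h2 hρ.le
    simp only [Finset.sum_const, Finset.card_univ, Fintype.card_fin, nsmul_eq_mul] at h1' h2'
    rw [hHinf]
    linarith
  have hdiff : ∀ t : ℝ, 0 ≤ t →
      |u t x - W (t ^ 2) t x| ≤ Real.exp (Real.exp 1 * ‖Hinf‖ * t - (t ^ 2 - ‖x‖)) := by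
    intro t ht
    have hw0 : ∀ y, (u 0 - W (t ^ 2) 0) y = 1 - ind (t ^ 2) y := by
      intro y; simp [hu0, hW0]
    refine abs_le_of_iterates_vanish Hinf (fun s => u s - W (t ^ 2) s) (fun s => ?_) ?_ x
      (t ^ 2 - ‖x‖) (fun n hn => ?_) ht
    · exact ((hu s).sub (hW (t ^ 2) s)).congr_deriv (map_sub Hinf _ _).symm
    · refine (BoundedContinuousFunction.norm_le zero_le_one).2 (fun y => ?_)
      rw [hw0, hind]
      by_cases h : y ∈ {y : Fin p → Fin d → ℤ | ∀ i j, |(y i j : ℝ)| ≤ t ^ 2}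
      · simp [Set.indicator_of_mem h]
      · simp [Set.indicator_of_notMem h]
    · refine pow_apply_eq_zero_of_range_one Hinf hrange _ (t ^ 2) (fun y hy => ?_) n x
        (fun i j => ?_)
      · rw [hw0, hind, Set.indicator_of_mem
          (show y ∈ {y : Fin p → Fin d → ℤ | ∀ i j, |(y i j : ℝ)| ≤ t ^ 2} from hy), sub_self]
      · have h : |(x i j : ℝ)| ≤ ‖x‖ :=
          (norm_le_pi_norm (x i) j).trans (norm_le_pi_norm x i)
        linarith
  have hlim : Tendsto (fun t : ℝ => Real.exp (Real.exp 1 * ‖Hinf‖ * t - (t ^ 2 - ‖x‖)))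
      atTop (𝓝 0) := by
    refine Real.tendsto_exp_atBot.comp ?_
    have h1 : Tendsto (fun t : ℝ => t * (Real.exp 1 * ‖Hinf‖ - t)) atTop atBot :=
      tendsto_id.atTop_mul_atBot₀ (tendsto_atBot_add_const_left _ _ tendsto_neg_atTop_atBot)
    refine (tendsto_atBot_add_const_right _ ‖x‖ h1).congr (fun t => ?_)
    ring
  rw [tendsto_iff_norm_sub_tendsto_zero]
  refine squeeze_zero' (Eventually.of_forall fun _ => norm_nonneg _) ?_ hlim
  filter_upwards [eventually_ge_atTop (0 : ℝ)] with t ht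
  have hpos := hu1 t ht
  have hne : u t x ≠ 0 := by linarith
  rw [div_sub_one hne, norm_div, Real.norm_eq_abs, Real.norm_of_nonneg (by linarith), abs_sub_comm]
  exact (div_le_self (abs_nonneg _) hpos).trans (hdiff t ht)
end
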